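/- arXiv:2204.01895 — 2 statements merged into one kernel-verified Lean document; each statement's English description precedes it below -/
import Mathlib

section
/- Let M be a definably complete locally o-minimal structure. The discrete closure operator discl on subsets of M satisfies the exchange property: for any A ⊆ M and a, b ∈ M, if a ∈ discl(A ∪ {b}) \ discl(A), then b ∈ discl(A ∪ {a}). -/
open FirstOrder Set

namespace Paper

variable (L : FirstOrder.Language)

/-- A subset of `Mⁿ` definable with arbitrary parameters from `M`. -/
def Def (M : Type*) [L.Structure M] {n : ℕ} (s : Set (Fin n → M)) : Prop :=
  Set.Definable (Set.univ : Set M) L s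

/-- A subset of `M` definable with arbitrary parameters from `M`. -/
def Def1 (M : Type*) [L.Structure M] (s : Set M) : Prop :=
  Def L M {f : Fin 1 → M | f 0 ∈ s}

/-- A subset of `M × M` definable with arbitrary parameters from `M`. -/
def Def2 (M : Type*) [L.Structure M] (s : Set (M × M)) : Prop :=
  Def L M {f : Fin 2 → M | (f 0, f 1) ∈ s}

/-- A discrete subset of a topological space. -/
def IsDiscrete {X : Type*} [TopologicalSpace X] (s : Set X) : Prop :=
  ∀ x ∈ s, ∃ U : Set X, IsOpen U ∧ x ∈ U ∧ U ∩ s = {x}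

/-- An open interval (with possibly infinite endpoints). -/
def IsOInterval {M : Type*} [Preorder M] (s : Set M) : Prop :=
  (∃ a b : M, s = Set.Ioo a b) ∨ (∃ a, s = Set.Ioi a) ∨ (∃ b, s = Set.Iio b) ∨ s = Set.univ

/-- A finite union of points and open intervals. -/
def FinUnionPtsIntervals {M : Type*} [Preorder M] (s : Set M) : Prop :=
  ∃ (F : Finset M) (n : ℕ) (J : Fin n → Set M),
    (∀ i, IsOInterval (J i)) ∧ s = ↑F ∪ ⋃ i, J i

/-- Local o-minimality. -/
def LocallyOMinimal (M : Type*) [L.Structure M] [LinearOrder M] : Prop :=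
  ∀ s : Set M, Def1 L M s → ∀ a : M,
    ∃ I : Set M, IsOInterval I ∧ a ∈ I ∧ FinUnionPtsIntervals (s ∩ I)

/-- Definable completeness. -/
def DefinablyComplete (M : Type*) [L.Structure M] [LinearOrder M] : Prop :=
  ∀ s : Set M, Def1 L M s → s.Nonempty →
    (BddAbove s → ∃ a, IsLUB s a) ∧ (BddBelow s → ∃ a, IsGLB s a)

/-- A coordinate projection of `X ⊆ Mⁿ` to `M^d` has image with nonempty interior. -/
def HasDimWit {M : Type*} [TopologicalSpace M] {n : ℕ} (X : Set (Fin n → M)) (d : ℕ) : Prop :=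
  ∃ σ : Fin d ↪ Fin n, (interior ((fun x => x ∘ σ) '' X)).Nonempty

/-- The projection dimension of a subset of `Mⁿ`, with `projDim ∅ = ⊥ = -∞`. -/
noncomputable def projDim {M : Type*} [TopologicalSpace M] {n : ℕ}
    (X : Set (Fin n → M)) : WithBot ℕ∞ :=
  ⨆ d ∈ {d : ℕ | HasDimWit X d}, ((d : ℕ∞) : WithBot ℕ∞)

/-- The discrete closure of `A ⊆ M`. -/
def discl (M : Type*) [L.Structure M] [TopologicalSpace M] (A : Set M) : Set M :=
  {x | ∃ s : Set M, Set.Definable A L {f : Fin 1 → M | f 0 ∈ s} ∧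
    IsDiscrete s ∧ IsClosed s ∧ x ∈ s}


end Paper

open Paper

namespace DisclExchange

variable {L : FirstOrder.Language} {M : Type*} [L.Structure M]

/-- A predicate on `Mⁿ` which is definable with parameters from `A`. -/
def Dfn (L : FirstOrder.Language) {M : Type*} [L.Structure M] (A : Set M) {n : ℕ}
    (P : (Fin n → M) → Prop) : Prop :=
  A.Definable L {v | P v}

/-- A map `Mⁿ → M` which is a coordinate or a constant from `A`. -/
def Term (A : Set M) {n : ℕ} (t : (Fin n → M) → M) : Prop :=
  ∃ s : A ⊕ Fin n, ∀ v, t v = Sum.elim (↑) v s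

theorem Term.var {A : Set M} {n : ℕ} (i : Fin n) : Term A (fun v : Fin n → M => v i) :=
  ⟨Sum.inr i, fun _ => rfl⟩

theorem Term.const {n : ℕ} (c : M) : Term univ (fun _ : Fin n → M => c) :=
  ⟨Sum.inl ⟨c, mem_univ c⟩, fun _ => rfl⟩

namespace Dfn

variable {A : Set M} {n : ℕ} {P Q : (Fin n → M) → Prop}

theorem and (hP : Dfn L A P) (hQ : Dfn L A Q) : Dfn L A (fun v => P v ∧ Q v) :=
  Definable.inter hP hQ

theorem or (hP : Dfn L A P) (hQ : Dfn L A Q) : Dfn L A (fun v => P v ∨ Q v) :=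
  Definable.union hP hQ

theorem not (hP : Dfn L A P) : Dfn L A (fun v => ¬ P v) :=
  Definable.compl hP

theorem imp (hP : Dfn L A P) (hQ : Dfn L A Q) : Dfn L A (fun v => P v → Q v) := by
  simpa only [imp_iff_not_or] using hP.not.or hQ

theorem ex {P : (Fin n → M) → M → Prop}
    (hP : Dfn L A (fun w : Fin (n + 1) → M => P (fun i => w i.castSucc) (w (Fin.last n)))) :
    Dfn L A (fun v => ∃ x, P v x) := by
  have h := Definable.image_comp hP (Fin.castSucc (n := n))
  refine (congrArg (A.Definable L) ?_).mp h
  ext v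
  constructor
  · rintro ⟨w, hw, rfl⟩
    exact ⟨_, hw⟩
  · rintro ⟨x, hx⟩
    refine ⟨Fin.snoc v x, ?_, ?_⟩
    · simpa using hx
    · ext i
      simp

theorem all {P : (Fin n → M) → M → Prop}
    (hP : Dfn L A (fun w : Fin (n + 1) → M => P (fun i => w i.castSucc) (w (Fin.last n)))) :
    Dfn L A (fun v => ∀ x, P v x) := by
  have h := (ex (P := fun v x => ¬ P v x) hP.not).not
  simpa only [not_exists, not_not] using h

theorem comp {k : ℕ} {R : (Fin k → M) → Prop} (hR : Dfn L A R)
    {t : Fin k → (Fin n → M) → M} (ht : ∀ i, Term A (t i)) :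
    Dfn L A (fun v => R (fun i => t i v)) := by
  obtain ⟨φ, hφ⟩ := definable_iff_exists_formula_sum.1 hR
  choose s hs using ht
  refine definable_iff_exists_formula_sum.2 ⟨φ.relabel (Sum.elim Sum.inl s), ?_⟩
  ext v
  have h : ∀ w, R w ↔ φ.Realize (Sum.elim (↑) w) := fun w => Set.ext_iff.1 hφ w
  rw [mem_ofPred_eq, h, mem_ofPred_eq, Language.Formula.realize_relabel]
  refine iff_of_eq (congrArg _ ?_)
  ext (a | i)
  · rfl
  · exact hs i v

theorem app₁ {s : M → Prop} (hs : Dfn L A (fun w : Fin 1 → M => s (w 0)))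
    {t : (Fin n → M) → M} (ht : Term A t) : Dfn L A (fun v => s (t v)) :=
  hs.comp (t := fun _ => t) fun _ => ht

theorem app₂ {R : M → M → Prop} (hR : Dfn L A (fun w : Fin 2 → M => R (w 0) (w 1)))
    {t₁ t₂ : (Fin n → M) → M} (h₁ : Term A t₁) (h₂ : Term A t₂) :
    Dfn L A (fun v => R (t₁ v) (t₂ v)) :=
  hR.comp (t := ![t₁, t₂]) (Fin.forall_fin_two.2 ⟨h₁, h₂⟩)

theorem app₃ {R : M → M → M → Prop}
    (hR : Dfn L A (fun w : Fin 3 → M => R (w 0) (w 1) (w 2)))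
    {t₁ t₂ t₃ : (Fin n → M) → M} (h₁ : Term A t₁) (h₂ : Term A t₂) (h₃ : Term A t₃) :
    Dfn L A (fun v => R (t₁ v) (t₂ v) (t₃ v)) :=
  hR.comp (t := ![t₁, t₂, t₃]) (by
    intro i
    fin_cases i
    exacts [h₁, h₂, h₃])

theorem mono {B : Set M} (hP : Dfn L A P) (h : A ⊆ B) : Dfn L B P :=
  Definable.mono hP h

/-- A predicate definable over `A ∪ {b}` is a specialization of one definable over `A`. -/
theorem exists_family {b : M} {s : M → Prop}
    (hs : Dfn L (A ∪ {b}) (fun w : Fin 1 → M => s (w 0))) :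
    ∃ R : M → M → Prop, Dfn L A (fun w : Fin 2 → M => R (w 0) (w 1)) ∧
      ∀ x, R x b ↔ s x := by
  classical
  obtain ⟨φ, hφ⟩ := definable_iff_exists_formula_sum.1 hs
  let g : ↑(A ∪ {b}) ⊕ Fin 1 → A ⊕ Fin 2 :=
    Sum.elim (fun a => if h : (a : M) ∈ A then Sum.inl ⟨a, h⟩ else Sum.inr 1) fun _ => Sum.inr 0
  refine ⟨fun x y => (φ.relabel g).Realize (Sum.elim (↑) ![x, y]),
    definable_iff_exists_formula_sum.2 ⟨φ.relabel g, ?_⟩, fun x => ?_⟩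
  · ext v
    have hv : ![v 0, v 1] = v := by
      ext i
      fin_cases i <;> rfl
    simp only [mem_ofPred_eq, hv]
  · have h : s x ↔ φ.Realize (Sum.elim (↑) fun _ : Fin 1 => x) :=
      Set.ext_iff.1 hφ fun _ => x
    beta_reduce
    rw [h, Language.Formula.realize_relabel]
    refine iff_of_eq (congrArg _ ?_)
    ext (⟨a, ha⟩ | i)
    · by_cases haA : a ∈ A
      · simp [g, haA]
      · simpa [g, haA] using (ha.resolve_left haA).symm
    · rfl

variable [L.IsOrdered] [LinearOrder M] [L.OrderedStructure M]

theorem lt {t₁ t₂ : (Fin n → M) → M} (h₁ : Term A t₁) (h₂ : Term A t₂) :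
    Dfn L A (fun v => t₁ v < t₂ v) := by
  obtain ⟨s₁, h₁⟩ := h₁
  obtain ⟨s₂, h₂⟩ := h₂
  refine definable_iff_exists_formula_sum.2
    ⟨Language.Term.lt (n := 0) (Language.Term.var (Sum.inl s₁))
      (Language.Term.var (Sum.inl s₂)), ?_⟩
  ext v
  simp [h₁, h₂, Language.Formula.Realize]

theorem le {t₁ t₂ : (Fin n → M) → M} (h₁ : Term A t₁) (h₂ : Term A t₂) :
    Dfn L A (fun v => t₁ v ≤ t₂ v) := by
  simpa only [not_lt] using (lt (L := L) h₂ h₁).not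

end Dfn

section Dichotomy

variable {M : Type*} {l : Filter M}

/-- The filter `l` decides membership in `s`. -/
def Decides (l : Filter M) (s : Set M) : Prop :=
  (∀ᶠ x in l, x ∈ s) ∨ ∀ᶠ x in l, x ∉ s

theorem Decides.compl {s : Set M} (hs : Decides l s) : Decides l sᶜ := by
  rcases hs with h | h
  · exact Or.inr (h.mono fun x hx hx' => hx' hx)
  · exact Or.inl h

theorem Decides.inter {s t : Set M} (hs : Decides l s) (ht : Decides l t) :
    Decides l (s ∩ t) := by
  rcases hs with h | h
  · rcases ht with h' | h'
    · exact Or.inl (h.and h')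
    · exact Or.inr (h'.mono fun x hx hx' => hx hx'.2)
  · exact Or.inr (h.mono fun x hx hx' => hx hx'.1)

theorem Decides.iUnion {ι : Type*} [Finite ι] {s : ι → Set M} (hs : ∀ i, Decides l (s i)) :
    Decides l (⋃ i, s i) := by
  by_cases h : ∃ i, ∀ᶠ x in l, x ∈ s i
  · obtain ⟨i, hi⟩ := h
    exact Or.inl (hi.mono fun x hx => mem_iUnion.2 ⟨i, hx⟩)
  · rw [not_exists] at h
    have h' : ∀ᶠ x in l, ∀ i, x ∉ s i := Filter.eventually_all.2 fun i => (hs i).resolve_left (h i)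
    exact Or.inr (h'.mono fun x hx hx' => (mem_iUnion.1 hx').elim hx)

theorem Decides.union {s t : Set M} (hs : Decides l s) (ht : Decides l t) :
    Decides l (s ∪ t) := by
  simpa [compl_inter] using (hs.compl.inter ht.compl).compl

variable [LinearOrder M]

theorem Decides.of_finUnionPtsIntervals (hl : ∀ b, Decides l (Ioi b))
    (hl' : ∀ b, Decides l (Iio b)) {s : Set M} (hs : FinUnionPtsIntervals s) :
    Decides l s := by
  obtain ⟨F, n, J, hJ, rfl⟩ := hs
  refine Decides.union ?_ (Decides.iUnion fun i => ?_)
  · have h : (F : Set M) = ⋃ i : F, {(i : M)} := by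
      ext
      simp
    rw [h]
    refine Decides.iUnion fun i => ?_
    have h : ({(i : M)} : Set M) = (Ioi (i : M))ᶜ ∩ (Iio (i : M))ᶜ := by
      ext x
      simp [le_antisymm_iff]
    rw [h]
    exact (hl i).compl.inter (hl' i).compl
  · rcases hJ i with ⟨a, b, h⟩ | ⟨a, h⟩ | ⟨b, h⟩ | h <;> rw [h]
    · exact (hl a).inter (hl' b)
    · exact hl a
    · exact hl' b
    · exact Or.inl (Filter.Eventually.of_forall mem_univ)

variable [TopologicalSpace M] [OrderTopology M]

theorem _root_.Paper.IsOInterval.isOpen {s : Set M} (hs : IsOInterval s) : IsOpen s := by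
  rcases hs with ⟨a, b, rfl⟩ | ⟨a, rfl⟩ | ⟨b, rfl⟩ | rfl
  exacts [isOpen_Ioo, isOpen_Ioi, isOpen_Iio, isOpen_univ]

theorem decides_nhdsGT_Ioi (a b : M) : Decides (nhdsWithin a (Ioi a)) (Ioi b) := by
  rcases le_or_gt b a with h | h
  · exact Or.inl (eventually_mem_nhdsWithin.mono fun x hx => h.trans_lt hx)
  · exact Or.inr ((eventually_lt_nhds h).filter_mono nhdsWithin_le_nhds |>.mono
      fun x hx => hx.not_gt)

theorem decides_nhdsGT_Iio (a b : M) : Decides (nhdsWithin a (Ioi a)) (Iio b) := by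
  rcases le_or_gt b a with h | h
  · exact Or.inr (eventually_mem_nhdsWithin.mono fun x hx => (h.trans_lt hx).not_gt)
  · exact Or.inl ((eventually_lt_nhds h).filter_mono nhdsWithin_le_nhds)

theorem decides_nhdsLT_Ioi (a b : M) : Decides (nhdsWithin a (Iio a)) (Ioi b) := by
  rcases le_or_gt a b with h | h
  · exact Or.inr (eventually_mem_nhdsWithin.mono fun x hx => (lt_of_lt_of_le hx h).not_gt)
  · exact Or.inl ((eventually_gt_nhds h).filter_mono nhdsWithin_le_nhds)

theorem decides_nhdsLT_Iio (a b : M) : Decides (nhdsWithin a (Iio a)) (Iio b) := by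
  rcases le_or_gt a b with h | h
  · exact Or.inl (eventually_mem_nhdsWithin.mono fun x hx => lt_of_lt_of_le hx h)
  · exact Or.inr ((eventually_gt_nhds h).filter_mono nhdsWithin_le_nhds |>.mono
      fun x hx => hx.not_gt)

theorem Decides.of_locallyOMinimal {L : FirstOrder.Language} [L.Structure M]
    (hlo : LocallyOMinimal L M) {s : Set M} (hs : Def1 L M s) {a : M} (hla : l ≤ nhds a)
    (hl : ∀ b, Decides l (Ioi b)) (hl' : ∀ b, Decides l (Iio b)) : Decides l s := by
  obtain ⟨I, hI, haI, hsI⟩ := hlo s hs a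
  have hI' : ∀ᶠ x in l, x ∈ I := hla (hI.isOpen.mem_nhds haI)
  rcases Decides.of_finUnionPtsIntervals hl hl' hsI with h | h
  · exact Or.inl (h.mono fun x hx => hx.1)
  · exact Or.inr ((h.and hI').mono fun x hx hx' => hx.1 ⟨hx', hx.2⟩)

end Dichotomy

section Small

set_option linter.unusedSectionVars false

variable {M : Type*} [LinearOrder M]

/-- A predicate is small if it holds on no nonempty open interval. -/
def Small (s : M → Prop) : Prop :=
  ∀ u v, u < v → ∃ x, u < x ∧ x < v ∧ ¬ s x

theorem Small.mono {s t : M → Prop} (ht : Small t) (h : ∀ x, s x → t x) : Small s := by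
  intro u v huv
  obtain ⟨x, h₁, h₂, h₃⟩ := ht u v huv
  exact ⟨x, h₁, h₂, fun hx => h₃ (h x hx)⟩

theorem not_small {s : M → Prop} (h : ¬ Small s) :
    ∃ u v, u < v ∧ ∀ x, u < x → x < v → s x := by
  simpa only [Small, not_forall, not_exists, not_and, not_not, exists_prop] using h

theorem Small.false {s : M → Prop} (hs : Small s) {u v : M} (huv : u < v)
    (h : ∀ x, u < x → x < v → s x) : False := by
  obtain ⟨x, h₁, h₂, h₃⟩ := hs u v huv
  exact h₃ (h x h₁ h₂)

variable [TopologicalSpace M] [OrderTopology M] [DenselyOrdered M] [NoMaxOrder M] [NoMinOrder M]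

theorem small_of_isDiscrete {s : M → Prop} (hs : Paper.IsDiscrete {x | s x}) : Small s := by
  by_contra h
  obtain ⟨u, v, huv, h⟩ := not_small h
  obtain ⟨x, hux, hxv⟩ := exists_between huv
  obtain ⟨U, hU, hxU, hUs⟩ := hs x (h x hux hxv)
  obtain ⟨y, hxy, hy⟩ := exists_Ico_subset_of_mem_nhds (hU.mem_nhds hxU) (exists_gt x)
  obtain ⟨z, hxz, hz⟩ := exists_between (lt_min hxy hxv)
  have hzs : z ∈ U ∩ {x | s x} :=
    ⟨hy ⟨hxz.le, hz.trans_le (min_le_left _ _)⟩,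
      h z (hux.trans hxz) (hz.trans_le (min_le_right _ _))⟩
  rw [hUs] at hzs
  exact hxz.ne' hzs

variable {L : FirstOrder.Language} [L.Structure M]

theorem dichotomy_right (hlo : LocallyOMinimal L M) {s : M → Prop}
    (hs : Dfn L univ (fun w : Fin 1 → M => s (w 0))) (a : M) :
    (∃ c, a < c ∧ ∀ x, a < x → x < c → s x) ∨ ∃ c, a < c ∧ ∀ x, a < x → x < c → ¬ s x := by
  refine (Decides.of_locallyOMinimal hlo (s := {x | s x}) hs (a := a)
    (l := nhdsWithin a (Ioi a)) nhdsWithin_le_nhds (decides_nhdsGT_Ioi a)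
    (decides_nhdsGT_Iio a)).imp ?_ ?_ <;>
  · intro h
    obtain ⟨c, hc, h⟩ := mem_nhdsGT_iff_exists_Ioo_subset.1 h
    exact ⟨c, hc, fun x h₁ h₂ => h ⟨h₁, h₂⟩⟩

theorem dichotomy_left (hlo : LocallyOMinimal L M) {s : M → Prop}
    (hs : Dfn L univ (fun w : Fin 1 → M => s (w 0))) (a : M) :
    (∃ c, c < a ∧ ∀ x, c < x → x < a → s x) ∨ ∃ c, c < a ∧ ∀ x, c < x → x < a → ¬ s x := by
  refine (Decides.of_locallyOMinimal hlo (s := {x | s x}) hs (a := a)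
    (l := nhdsWithin a (Iio a)) nhdsWithin_le_nhds (decides_nhdsLT_Ioi a)
    (decides_nhdsLT_Iio a)).imp ?_ ?_ <;>
  · intro h
    obtain ⟨c, hc, h⟩ := mem_nhdsLT_iff_exists_Ioo_subset.1 h
    exact ⟨c, hc, fun x h₁ h₂ => h ⟨h₁, h₂⟩⟩

theorem Small.right (hlo : LocallyOMinimal L M) {s : M → Prop}
    (hs : Dfn L univ (fun w : Fin 1 → M => s (w 0))) (hsm : Small s) (a : M) :
    ∃ c, a < c ∧ ∀ x, a < x → x < c → ¬ s x :=
  (dichotomy_right hlo hs a).resolve_left fun ⟨_, hc, h⟩ => hsm.false hc h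

theorem Small.left (hlo : LocallyOMinimal L M) {s : M → Prop}
    (hs : Dfn L univ (fun w : Fin 1 → M => s (w 0))) (hsm : Small s) (a : M) :
    ∃ c, c < a ∧ ∀ x, c < x → x < a → ¬ s x :=
  (dichotomy_left hlo hs a).resolve_left fun ⟨_, hc, h⟩ => hsm.false hc h

theorem Small.or (hlo : LocallyOMinimal L M) {s t : M → Prop}
    (hs : Dfn L univ (fun w : Fin 1 → M => s (w 0))) (hsm : Small s) (htm : Small t) :
    Small (fun x => s x ∨ t x) := by
  by_contra h
  obtain ⟨u, v, huv, h⟩ := not_small h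
  obtain ⟨x, hux, hxv⟩ := exists_between huv
  obtain ⟨c, hxc, hc⟩ := hsm.right hlo hs x
  exact htm.false (lt_min hxc hxv) fun y h₁ h₂ =>
    (h y (hux.trans h₁) (h₂.trans_le (min_le_right _ _))).resolve_left
      (hc y h₁ (h₂.trans_le (min_le_left _ _)))

/-- A small definable predicate holds only at isolated points, which do not accumulate. -/
theorem Small.exists_isOpen (hlo : LocallyOMinimal L M) {s : M → Prop}
    (hs : Dfn L univ (fun w : Fin 1 → M => s (w 0))) (hsm : Small s) (a : M) :
    ∃ U, IsOpen U ∧ a ∈ U ∧ ∀ x ∈ U, s x → x = a := by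
  obtain ⟨c, hac, hc⟩ := hsm.right hlo hs a
  obtain ⟨d, hda, hd⟩ := hsm.left hlo hs a
  refine ⟨Ioo d c, isOpen_Ioo, ⟨hda, hac⟩, fun x hx hsx => ?_⟩
  rcases lt_trichotomy x a with h | h | h
  · exact absurd hsx (hd x hx.1 h)
  · exact h
  · exact absurd hsx (hc x h hx.2)

theorem Small.isDiscrete (hlo : LocallyOMinimal L M) {s : M → Prop}
    (hs : Dfn L univ (fun w : Fin 1 → M => s (w 0))) (hsm : Small s) :
    Paper.IsDiscrete {x | s x} := by
  intro a ha
  obtain ⟨U, hU, haU, h⟩ := hsm.exists_isOpen hlo hs a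
  exact ⟨U, hU, haU, Subset.antisymm (fun x hx => h x hx.1 hx.2) (by rintro x rfl; exact ⟨haU, ha⟩)⟩

theorem Small.isClosed (hlo : LocallyOMinimal L M) {s : M → Prop}
    (hs : Dfn L univ (fun w : Fin 1 → M => s (w 0))) (hsm : Small s) :
    IsClosed {x | s x} := by
  refine isOpen_compl_iff.1 (isOpen_iff_mem_nhds.2 fun a ha => ?_)
  obtain ⟨U, hU, haU, h⟩ := hsm.exists_isOpen hlo hs a
  exact Filter.mem_of_superset (hU.mem_nhds haU) fun x hx hsx => ha (h x hx hsx ▸ hsx)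

theorem mem_discl (hlo : LocallyOMinimal L M) {A : Set M} {s : M → Prop}
    (hs : Dfn L A (fun w : Fin 1 → M => s (w 0))) (hsm : Small s) {a : M} (ha : s a) :
    a ∈ discl L M A :=
  ⟨{x | s x}, hs, hsm.isDiscrete hlo (hs.mono (subset_univ A)),
    hsm.isClosed hlo (hs.mono (subset_univ A)), ha⟩

theorem Small.exists_min (hlo : LocallyOMinimal L M) (hdc : DefinablyComplete L M) {s : M → Prop}
    (hs : Dfn L univ (fun w : Fin 1 → M => s (w 0))) (hsm : Small s) {a b : M} (ha : s a)
    (hb : ∀ x, s x → b ≤ x) : ∃ m, s m ∧ ∀ x, s x → m ≤ x := by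
  obtain ⟨m, hm⟩ := (hdc {x | s x} hs ⟨a, ha⟩).2 ⟨b, fun x hx => hb x hx⟩
  refine ⟨m, ?_, fun x hx => hm.1 hx⟩
  by_contra hms
  obtain ⟨c, hmc, hc⟩ := hsm.right hlo hs m
  refine hmc.not_ge (hm.2 fun x hx => le_of_not_gt fun hxc => ?_)
  rcases (hm.1 hx).lt_or_eq with h | h
  · exact hc x h hxc hx
  · exact hms (h ▸ hx)

theorem Small.exists_max (hlo : LocallyOMinimal L M) (hdc : DefinablyComplete L M) {s : M → Prop}
    (hs : Dfn L univ (fun w : Fin 1 → M => s (w 0))) (hsm : Small s) {a b : M} (ha : s a)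
    (hb : ∀ x, s x → x ≤ b) : ∃ m, s m ∧ ∀ x, s x → x ≤ m := by
  obtain ⟨m, hm⟩ := (hdc {x | s x} hs ⟨a, ha⟩).1 ⟨b, fun x hx => hb x hx⟩
  refine ⟨m, ?_, fun x hx => hm.1 hx⟩
  by_contra hms
  obtain ⟨c, hmc, hc⟩ := hsm.left hlo hs m
  refine hmc.not_ge (hm.2 fun x hx => le_of_not_gt fun hxc => ?_)
  rcases (hm.1 hx).lt_or_eq with h | h
  · exact hc x hxc h hx
  · exact hms (h ▸ hx)

theorem Dfn.small {A : Set M} [L.IsOrdered] [L.OrderedStructure M] {n : ℕ}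
    {P : (Fin n → M) → M → Prop}
    (hP : Dfn L A (fun w : Fin (n + 1) → M => P (fun i => w i.castSucc) (w (Fin.last n)))) :
    Dfn L A (fun v => Small (P v)) := by
  refine Dfn.all (Dfn.all (Dfn.imp (Dfn.lt (Term.var _) (Term.var _)) (Dfn.ex ?_)))
  refine Dfn.and (Dfn.lt (Term.var _) (Term.var _)) (Dfn.and (Dfn.lt (Term.var _) (Term.var _)) ?_)
  have h := (hP.comp (n := n + 3)
    (t := Fin.snoc (α := fun _ => (Fin (n + 3) → M) → M)
      (fun i v => v i.castSucc.castSucc.castSucc) fun v => v (Fin.last _))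
    (Fin.lastCases (by simpa using Term.var _) fun i => by simpa using Term.var _)).not
  simpa using h

variable [L.IsOrdered] [L.OrderedStructure M]

theorem Small.iUnion_of_bounded (hlo : LocallyOMinimal L M) (hdc : DefinablyComplete L M)
    {D : M → Prop} {T : M → M → Prop} (hD : Dfn L univ (fun w : Fin 1 → M => D (w 0)))
    (hT : Dfn L univ (fun w : Fin 2 → M => T (w 0) (w 1))) (hDs : Small D)
    (hTs : ∀ d, D d → Small (T d)) {a b : M} (hab : ∀ d, D d → a ≤ d ∧ d ≤ b) :
    Small (fun x => ∃ d, D d ∧ T d x) := by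
  by_contra h
  have hD' : ∃ d, D d := by
    by_contra hD'
    exact h fun u v huv => (exists_between huv).imp fun x hx =>
      ⟨hx.1, hx.2, fun ⟨d, hd, _⟩ => hD' ⟨d, hd⟩⟩
  obtain ⟨d, hd⟩ := hD'
  obtain ⟨m, hm, hmax⟩ := hDs.exists_max hlo hdc hD hd fun x hx => (hab x hx).2
  have hU : ∀ d, Dfn L univ (fun w : Fin 1 → M => ∃ d', D d' ∧ d' ≤ d ∧ T d' (w 0)) := fun d => by
    apply_rules [hD.app₁, hT.app₂, Dfn.and, Dfn.ex, Dfn.le, Term.var, Term.const]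
  have hE : Dfn L univ (fun w : Fin 1 → M =>
      D (w 0) ∧ ¬ Small fun x => ∃ d', D d' ∧ d' ≤ w 0 ∧ T d' x) := by
    apply_rules [hD.app₁, hT.app₂, Dfn.and, Dfn.not, Dfn.small, Dfn.ex, Dfn.le, Term.var]
  obtain ⟨e, ⟨heD, he⟩, hmin⟩ := (hDs.mono (s := fun d =>
      D d ∧ ¬ Small fun x => ∃ d', D d' ∧ d' ≤ d ∧ T d' x) fun _ h => h.1).exists_min hlo hdc hE
    (a := m) ⟨hm, fun hs => h (hs.mono fun x ⟨d, hd, hx⟩ => ⟨d, hd, hmax d hd, hx⟩)⟩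
    fun x hx => (hab x hx.1).1
  apply he
  by_cases hlt : ∃ d, D d ∧ d < e
  · obtain ⟨d, hd⟩ := hlt
    obtain ⟨e', ⟨heD', hee'⟩, hmax'⟩ := (hDs.mono (s := fun d => D d ∧ d < e)
      fun _ h => h.1).exists_max hlo hdc
        (hD.and (Dfn.lt (Term.var 0) (Term.const e))) hd fun x hx => hx.2.le
    have he' : Small fun x => ∃ d', D d' ∧ d' ≤ e' ∧ T d' x :=
      not_not.1 fun hs => (hmin e' ⟨heD', hs⟩).not_gt hee'
    refine (he'.or hlo (hU e') (hTs e heD)).mono ?_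
    rintro x ⟨d, hd, hde, hx⟩
    rcases hde.lt_or_eq with h | rfl
    · exact Or.inl ⟨d, hd, hmax' d ⟨hd, h⟩, hx⟩
    · exact Or.inr hx
  · refine (hTs e heD).mono ?_
    rintro x ⟨d, hd, hde, hx⟩
    rcases hde.lt_or_eq with h | rfl
    · exact absurd ⟨d, hd, h⟩ hlt
    · exact hx

/-- A definable relation on a nonempty open interval with nonempty sections in one direction and
small sections in the other cannot be locally comparable on the right. -/
theorem false_of_small_fibers (hlo : LocallyOMinimal L M) (hdc : DefinablyComplete L M)
    {G : M → M → Prop} (hG : Dfn L univ (fun w : Fin 2 → M => G (w 0) (w 1))) {p q : M}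
    (hpq : p < q) (hne : ∀ x, p < x → x < q → ∃ z, G x z)
    (hsm : ∀ z, Small fun x => p < x ∧ x < q ∧ G x z)
    (hcmp : ∀ x z, p < x → x < q → G x z →
      ∃ c, x < c ∧ ∀ y, x < y → y < c → y < q → ∀ z', G y z' → G x z' ∨ G y z) : False := by
  have hB : Dfn L univ (fun w : Fin 1 → M =>
      p < w 0 ∧ w 0 < q ∧ ∀ y, p < y → y < w 0 → ∃ z, G (w 0) z ∧ ¬ G y z) := by
    apply_rules [hG.app₂, Dfn.and, Dfn.not, Dfn.all, Dfn.ex, Dfn.imp, Dfn.lt, Term.var, Term.const]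
  have hGz : ∀ z, Dfn L univ (fun w : Fin 1 → M => p < w 0 ∧ w 0 < q ∧ G (w 0) z) := fun z => by
    apply_rules [hG.app₂, Dfn.and, Dfn.lt, Term.var, Term.const]
  rcases dichotomy_right hlo (s := fun x =>
    p < x ∧ x < q ∧ ∀ y, p < y → y < x → ∃ z, G x z ∧ ¬ G y z) hB p with
    ⟨e, hpe, he⟩ | ⟨e, hpe, he⟩
  · obtain ⟨x, hpx, hxe⟩ := exists_between hpe
    obtain ⟨-, hxq, -⟩ := he x hpx hxe
    obtain ⟨z, hz⟩ := hne x hpx hxq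
    obtain ⟨c, hxc, hc⟩ := hcmp x z hpx hxq hz
    obtain ⟨d, hxd, hd⟩ := (hsm z).right hlo (hGz z) x
    obtain ⟨y, hxy, hy⟩ := exists_between (lt_min hxc (lt_min hxd hxe))
    obtain ⟨hyc, hyd, hye⟩ : y < c ∧ y < d ∧ y < e := by simpa only [lt_min_iff] using hy
    obtain ⟨hpy, hyq, hyB⟩ := he y (hpx.trans hxy) hye
    obtain ⟨z', hyz', hxz'⟩ := hyB x hpx hxy
    exact hd y hxy hyd ⟨hpy, hyq, (hc y hxy hyc hyq z' hyz').resolve_left hxz'⟩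
  · obtain ⟨x, hpx, hx⟩ := exists_between (lt_min hpe hpq)
    obtain ⟨hxe, hxq⟩ := lt_min_iff.1 hx
    obtain ⟨z, hz⟩ := hne x hpx hxq
    obtain ⟨m, ⟨⟨hpm, hmq, hmz⟩, hmx⟩, hmin⟩ := ((hsm z).mono
      (s := fun y => (p < y ∧ y < q ∧ G y z) ∧ y ≤ x) fun _ h => h.1).exists_min hlo hdc
        ((hGz z).and (Dfn.le (Term.var 0) (Term.const x))) (a := x) ⟨⟨hpx, hxq, hz⟩, le_rfl⟩
        fun y hy => hy.1.1.le
    refine he m hpm (hmx.trans_lt hxe) ⟨hpm, hmq, fun y hpy hym => ⟨z, hmz, fun hyz => ?_⟩⟩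
    exact (hmin y ⟨⟨hpy, hym.trans hmq, hyz⟩, hym.le.trans hmx⟩).not_gt hym

theorem exists_not_small_of_antitone (hlo : LocallyOMinimal L M) (hdc : DefinablyComplete L M)
    {G : M → M → Prop} (hG : Dfn L univ (fun w : Fin 2 → M => G (w 0) (w 1)))
    (hne : ¬ Small fun x => ∃ z, G x z) (hanti : ∀ x z z', z' ≤ z → G x z → G x z') :
    ∃ z, ¬ Small fun x => G x z := by
  by_contra! h
  obtain ⟨p, q, hpq, hne⟩ := not_small hne
  refine false_of_small_fibers hlo hdc hG hpq hne (fun z => (h z).mono fun _ h => h.2.2)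
    fun x z hpx hxq hz => ⟨q, hxq, fun y hxy _ hyq z' hz' => ?_⟩
  exact (le_total z z').elim (fun h => Or.inr (hanti y z' z h hz')) fun h =>
    Or.inl (hanti x z z' h hz)

theorem exists_not_small_of_monotone (hlo : LocallyOMinimal L M) (hdc : DefinablyComplete L M)
    {G : M → M → Prop} (hG : Dfn L univ (fun w : Fin 2 → M => G (w 0) (w 1)))
    (hne : ¬ Small fun x => ∃ z, G x z) (hmono : ∀ x z z', z ≤ z' → G x z → G x z') :
    ∃ z, ¬ Small fun x => G x z := by
  by_contra! h
  obtain ⟨p, q, hpq, hne⟩ := not_small hne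
  refine false_of_small_fibers hlo hdc hG hpq hne (fun z => (h z).mono fun _ h => h.2.2)
    fun x z hpx hxq hz => ⟨q, hxq, fun y hxy _ hyq z' hz' => ?_⟩
  exact (le_total z z').elim (fun h => Or.inl (hmono x z z' h hz)) fun h =>
    Or.inr (hmono y z' z h hz')

theorem Small.iUnion (hlo : LocallyOMinimal L M) (hdc : DefinablyComplete L M)
    {D : M → Prop} {T : M → M → Prop} (hD : Dfn L univ (fun w : Fin 1 → M => D (w 0)))
    (hT : Dfn L univ (fun w : Fin 2 → M => T (w 0) (w 1))) (hDs : Small D)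
    (hTs : ∀ d, D d → Small (T d)) : Small (fun x => ∃ d, D d ∧ T d x) := by
  by_contra h
  obtain ⟨a, ha⟩ := exists_not_small_of_antitone hlo hdc
    (G := fun x t => ∃ d, D d ∧ t ≤ d ∧ T d x)
    (by apply_rules [hD.app₁, hT.app₂, Dfn.and, Dfn.ex, Dfn.le, Term.var])
    (fun hs => h (hs.mono fun x ⟨d, hd, hx⟩ => ⟨d, d, hd, le_rfl, hx⟩))
    fun x z z' hz ⟨d, hd, hzd, hx⟩ => ⟨d, hd, hz.trans hzd, hx⟩
  obtain ⟨b, hb⟩ := exists_not_small_of_monotone hlo hdc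
    (G := fun x t => ∃ d, (D d ∧ a ≤ d ∧ d ≤ t) ∧ T d x)
    (by apply_rules [hD.app₁, hT.app₂, Dfn.and, Dfn.ex, Dfn.le, Term.var, Term.const])
    (fun hs => ha (hs.mono fun x ⟨d, hd, had, hx⟩ => ⟨d, d, ⟨hd, had, le_rfl⟩, hx⟩))
    fun x z z' hz ⟨d, ⟨hd, had, hdz⟩, hx⟩ => ⟨d, ⟨hd, had, hdz.trans hz⟩, hx⟩
  refine hb (Small.iUnion_of_bounded hlo hdc (D := fun d => D d ∧ a ≤ d ∧ d ≤ b) ?_ hT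
    (hDs.mono fun _ h => h.1) (fun d hd => hTs d hd.1) fun d hd => hd.2)
  apply_rules [hD.app₁, Dfn.and, Dfn.le, Term.var, Term.const]

/-- If the sections `S x` are open to the left and the fibers over each `y` are small, then the
domain of `S` is small. -/
theorem small_domain (hlo : LocallyOMinimal L M) (hdc : DefinablyComplete L M)
    {S : M → M → Prop} (hS : Dfn L univ (fun w : Fin 2 → M => S (w 0) (w 1)))
    (hopen : ∀ x y, S x y → ∃ u v, u < y ∧ y < v ∧ ∀ w, u < w → w < v → S x w)
    (hfib : ∀ y, Small fun x => S x y) : Small (fun x => ∃ y, S x y) := by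
  by_contra hdom
  obtain ⟨c, hc⟩ := exists_not_small_of_antitone hlo hdc (G := fun x z => ∃ y, z < y ∧ S x y)
    (by apply_rules [hS.app₂, Dfn.and, Dfn.ex, Dfn.lt, Term.var])
    (fun hs => hdom (hs.mono fun x ⟨y, hy⟩ => (exists_lt y).imp fun z hz => ⟨y, hz, hy⟩))
    fun x z z' hz ⟨y, hzy, hy⟩ => ⟨y, hz.trans_lt hzy, hy⟩
  -- `Q y z x` says that `S x` contains `(y, z]`, and `F x y` that `y` is a left endpoint of `S x`
  let Q : M → M → M → Prop := fun y z x => y < z ∧ ∀ w, y < w → w ≤ z → c < w ∧ S x w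
  let F : M → M → Prop := fun x y => ¬ (c < y ∧ S x y) ∧ ∃ z, Q y z x
  have hQ : Dfn L univ (fun w : Fin 3 → M => Q (w 0) (w 1) (w 2)) := by
    apply_rules [hS.app₂, Dfn.and, Dfn.all, Dfn.imp, Dfn.lt, Dfn.le, Term.var, Term.const]
  have hF : Dfn L univ (fun w : Fin 2 → M => F (w 0) (w 1)) := by
    apply_rules [hS.app₂, hQ.app₃, Dfn.and, Dfn.not, Dfn.ex, Dfn.lt, Term.var, Term.const]
  have hFx : ∀ x, Small (F x) := by
    intro x
    by_contra h
    obtain ⟨u, v, huv, h⟩ := not_small h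
    obtain ⟨y, huy, hyv⟩ := exists_between huv
    obtain ⟨-, z, hyz, hz⟩ := h y huy hyv
    obtain ⟨w, hyw, hw⟩ := exists_between (lt_min hyz hyv)
    exact (h w (huy.trans hyw) (hw.trans_le (min_le_right _ _))).1
      (hz w hyw (hw.trans_le (min_le_left _ _)).le)
  have hFy : ∀ y, Small fun x => F x y := by
    intro y
    by_contra h
    obtain ⟨p, q, hpq, h⟩ := not_small h
    refine false_of_small_fibers hlo hdc (G := fun x z => Q y z x) ?_ hpq
      (fun x hpx hxq => (h x hpx hxq).2)
      (fun z => (hfib z).mono fun x hx => (hx.2.2.2 z hx.2.2.1 le_rfl).2)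
      fun x z hpx hxq hz => ⟨q, hxq, fun x' hxx' _ hxq' z' hz' => ?_⟩
    · apply_rules [hQ.app₃, Term.var, Term.const]
    · rcases le_total z z' with hzz' | hzz'
      · exact Or.inr ⟨hz.1, fun w h₁ h₂ => hz'.2 w h₁ (h₂.trans hzz')⟩
      · exact Or.inl ⟨hz'.1, fun w h₁ h₂ => hz.2 w h₁ (h₂.trans hzz')⟩
  have hne : ∀ x, (∃ y, c < y ∧ S x y) → ∃ y, F x y := by
    rintro x ⟨z, hcz, hz⟩
    have hopen' : ∀ y, c < y ∧ S x y →
        ∃ u v, u < y ∧ y < v ∧ ∀ w, u < w → w < v → c < w ∧ S x w := by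
      rintro y ⟨hcy, hy⟩
      obtain ⟨u, v, huy, hyv, h⟩ := hopen x y hy
      exact ⟨max u c, v, max_lt huy hcy, hyv, fun w h₁ h₂ =>
        ⟨(le_max_right _ _).trans_lt h₁, h w ((le_max_left _ _).trans_lt h₁) h₂⟩⟩
    have hdef : Dfn L univ (fun w : Fin 1 → M => w 0 ≤ z ∧ ¬ (c < w 0 ∧ S x (w 0))) := by
      apply_rules [hS.app₂, Dfn.and, Dfn.not, Dfn.lt, Dfn.le, Term.var, Term.const]
    obtain ⟨y, hy⟩ := (hdc {y | y ≤ z ∧ ¬ (c < y ∧ S x y)} hdef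
      ⟨c, hcz.le, fun h => h.1.false⟩).1 ⟨z, fun y hy => hy.1⟩
    have hyz : y ≤ z := hy.2 fun y hy => hy.1
    have hyS : ¬ (c < y ∧ S x y) := by
      intro h
      obtain ⟨u, v, huy, hyv, huv⟩ := hopen' y h
      refine huy.not_ge (hy.2 fun w hw => le_of_not_gt fun huw => hw.2 ?_)
      exact huv w huw ((hy.1 hw).trans_lt hyv)
    refine ⟨y, hyS, z, hyz.lt_of_ne ?_, fun w hyw hwz => ?_⟩
    · rintro rfl
      exact hyS ⟨hcz, hz⟩
    · by_contra hw
      exact (hy.1 ⟨hwz, hw⟩).not_gt hyw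
  obtain ⟨p, q, hpq, hI⟩ := not_small hc
  have hrange : ¬ Small fun y => ∃ x, (p < x ∧ x < q) ∧ F x y := by
    intro h
    have hD : Dfn L univ (fun w : Fin 1 → M => ∃ x, (p < x ∧ x < q) ∧ F x (w 0)) := by
      apply_rules [hF.app₂, Dfn.and, Dfn.ex, Dfn.lt, Term.var, Term.const]
    refine (h.iUnion hlo hdc hD (T := fun y x => F x y) (hF.app₂ (Term.var 1) (Term.var 0))
      fun y _ => hFy y).false hpq fun x hpx hxq => ?_
    obtain ⟨y, hy⟩ := hne x (hI x hpx hxq)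
    exact ⟨y, ⟨x, ⟨hpx, hxq⟩, hy⟩, hy⟩
  obtain ⟨r, s, hrs, hJ⟩ := not_small hrange
  -- `K x y` says that `x` is the least point of `(p, q)` with `F x y`
  let K : M → M → Prop := fun x y => ((p < x ∧ x < q) ∧ F x y) ∧
    ∀ x', (p < x' ∧ x' < q) ∧ F x' y → x ≤ x'
  have hK : Dfn L univ (fun w : Fin 2 → M => K (w 0) (w 1)) := by
    apply_rules [hF.app₂, Dfn.and, Dfn.all, Dfn.imp, Dfn.lt, Dfn.le, Term.var, Term.const]
  refine false_of_small_fibers hlo hdc (G := fun y z => ∃ x, K x y ∧ Q y z x) ?_ hrs ?_ ?_ ?_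
  · apply_rules [hK.app₂, hQ.app₃, Dfn.and, Dfn.ex, Term.var]
  · intro y hry hys
    obtain ⟨x, hx⟩ := hJ y hry hys
    have hdef : Dfn L univ (fun w : Fin 1 → M => (p < w 0 ∧ w 0 < q) ∧ F (w 0) y) := by
      apply_rules [hF.app₂, Dfn.and, Dfn.lt, Term.var, Term.const]
    obtain ⟨m, hm, hmin⟩ := ((hFy y).mono (s := fun x => (p < x ∧ x < q) ∧ F x y)
      fun _ h => h.2).exists_min hlo hdc hdef hx fun x hx => hx.1.1.le
    obtain ⟨z, hz⟩ := hm.2.2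
    exact ⟨z, m, ⟨hm, hmin⟩, hz⟩
  · intro z
    refine (Small.iUnion hlo hdc (D := fun x => S x z) (hS.app₂ (Term.var 0) (Term.const z)) hF
      (hfib z) fun x _ => hFx x).mono ?_
    rintro y ⟨-, -, x, hx, hz⟩
    exact ⟨x, (hz.2 z hz.1 le_rfl).2, hx.1.2⟩
  · rintro y z - - ⟨x, hx, hz⟩
    refine ⟨z, hz.1, fun y' hyy' hy'z _ z' ⟨x', hx', hz'⟩ => ?_⟩
    rcases le_or_gt z' z with h | h
    · exact Or.inl ⟨x, hx, hyy'.trans hz'.1, fun w h₁ h₂ => hz.2 w h₁ (h₂.trans h)⟩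
    · exact Or.inr ⟨x', hx', hy'z, fun w h₁ h₂ => hz'.2 w h₁ (h₂.trans h.le)⟩

end Small

end DisclExchange

open DisclExchange

/-- In a definably complete locally o-minimal structure, the discrete closure operator
satisfies the exchange property: if `a ∈ discl (A ∪ {b}) \ discl A`, then
`b ∈ discl (A ∪ {a})`. -/
theorem discl_exchange
    {L : FirstOrder.Language} {M : Type*} [L.IsOrdered] [LinearOrder M] [L.Structure M]
    [L.OrderedStructure M] [DenselyOrdered M] [NoMaxOrder M] [NoMinOrder M]
    [TopologicalSpace M] [OrderTopology M]
    (hlo : LocallyOMinimal L M) (hdc : DefinablyComplete L M)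
    (A : Set M) (a b : M)
    (h : a ∈ discl L M (A ∪ {b}) \ discl L M A) :
    b ∈ discl L M (A ∪ {a}) := by
  obtain ⟨⟨D, hD, hDdisc, -, haD⟩, haA⟩ := h
  obtain ⟨R, hR, hRD⟩ := Dfn.exists_family (s := (· ∈ D)) hD
  let X : M → M → Prop := fun x y => R x y ∧ Small fun x' => R x' y
  let S : M → M → Prop := fun x y =>
    ∃ u v, u < y ∧ y < v ∧ ∀ w, u < w → w < v → X x w
  have hX : Dfn L A (fun w : Fin 2 → M => X (w 0) (w 1)) := by
    apply_rules [hR.app₂, Dfn.and, Dfn.small, Term.var]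
  have hS : Dfn L A (fun w : Fin 2 → M => S (w 0) (w 1)) := by
    apply_rules [hX.app₂, Dfn.and, Dfn.ex, Dfn.all, Dfn.imp, Dfn.lt, Term.var]
  have hSX : ∀ x y, S x y → X x y := fun x y ⟨u, v, huy, hyv, h⟩ => h y huy hyv
  have hab : X a b := by
    refine ⟨(hRD a).2 haD, ?_⟩
    simpa only [hRD] using small_of_isDiscrete (s := (· ∈ D)) hDdisc
  by_cases hSab : S a b
  · refine absurd (mem_discl hlo (s := fun x => ∃ y, S x y) ?_ ?_ ⟨b, hSab⟩) haA
    · exact Dfn.ex (hS.app₂ (Term.var _) (Term.var _))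
    · refine small_domain hlo hdc (hS.mono (subset_univ A)) ?_ fun y => ?_
      · rintro x y ⟨u, v, huy, hyv, h⟩
        exact ⟨u, v, huy, hyv, fun w h₁ h₂ => ⟨u, v, h₁, h₂, h⟩⟩
      · by_contra h
        obtain ⟨p, q, hpq, h⟩ := not_small h
        obtain ⟨x, hpx, hxq⟩ := exists_between hpq
        exact (hSX x y (h x hpx hxq)).2.false hpq fun x h₁ h₂ => (hSX x y (h x h₁ h₂)).1
  · refine mem_discl hlo (s := fun y => X a y ∧ ¬ S a y) ?_ ?_ ⟨hab, hSab⟩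
    · have ha : Term (A ∪ {a}) (fun _ : Fin 1 → M => a) :=
        ⟨Sum.inl ⟨a, Or.inr rfl⟩, fun _ => rfl⟩
      exact ((hX.mono subset_union_left).app₂ ha (Term.var 0)).and
        ((hS.mono subset_union_left).app₂ ha (Term.var 0)).not
    · by_contra h
      obtain ⟨u, v, huv, h⟩ := not_small h
      obtain ⟨y, huy, hyv⟩ := exists_between huv
      exact (h y huy hyv).2 ⟨u, v, huy, hyv, fun w h₁ h₂ => (h w h₁ h₂).1⟩
end

section
/- Let T be a definably complete locally o-minimal theory, M ⊨ T, A ⊆ M, and X ⊆ M^n definable over A. Then dim X = rk(X/A), where rk is the rank computed in a monster model using the discrete-closure pregeometry: rk(X/A) = max over points (a₁,…,aₙ) ∈ X(𝕄) of the size of a discl-basis of {a₁,…,aₙ} over A. -/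
open FirstOrder Set

open Paper

namespace Paper

/-- `N` realizes every finitely-realized set of one-variable formulas with parameters
from a subset of `N` of cardinality `< κ` (i.e. `N` is `κ`-saturated); this is the
property of a monster model over small parameter sets. -/
def RealizesSmallTypes (L : FirstOrder.Language) (N : Type u) [L.Structure N]
    (κ : Cardinal.{u}) : Prop :=
  ∀ S : Set N, Cardinal.mk S < κ →
    ∀ p : Set ((L[[S]]).Formula (Fin 1)),
      (∀ t : Finset ((L[[S]]).Formula (Fin 1)), ↑t ⊆ p →
        ∃ v : Fin 1 → N, ∀ φ ∈ t, φ.Realize v) →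
      ∃ v : Fin 1 → N, ∀ φ ∈ p, φ.Realize v

end Paper

namespace LocOMin

open FirstOrder Language

universe u v w

section Dfb

variable {L : FirstOrder.Language.{v, w}} {M : Type u} [L.Structure M] {A : Set M} {α : Type}

/-- A predicate on tuples that is definable with parameters from `A`. -/
def Dfb (L : FirstOrder.Language.{v, w}) {M : Type u} [L.Structure M] (A : Set M) {α : Type}
    (P : (α → M) → Prop) : Prop :=
  A.Definable L {x | P x}

/-- A definable unary predicate. -/
def D1 (L : FirstOrder.Language.{v, w}) {M : Type u} [L.Structure M] (A : Set M)
    (P : M → Prop) : Prop :=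
  Dfb L A (fun x : Fin 1 → M => P (x 0))

/-- A definable binary predicate. -/
def D2 (L : FirstOrder.Language.{v, w}) {M : Type u} [L.Structure M] (A : Set M)
    (R : M → M → Prop) : Prop :=
  Dfb L A (fun x : Fin 2 → M => R (x 0) (x 1))

theorem Dfb.mono {B : Set M} {P : (α → M) → Prop} (h : Dfb L A P) (hAB : A ⊆ B) : Dfb L B P :=
  Set.Definable.mono h hAB

theorem Dfb.and {P Q : (α → M) → Prop} (hP : Dfb L A P) (hQ : Dfb L A Q) :
    Dfb L A (fun x => P x ∧ Q x) :=
  Set.Definable.inter hP hQ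

theorem Dfb.or {P Q : (α → M) → Prop} (hP : Dfb L A P) (hQ : Dfb L A Q) :
    Dfb L A (fun x => P x ∨ Q x) :=
  Set.Definable.union hP hQ

theorem Dfb.not {P : (α → M) → Prop} (hP : Dfb L A P) : Dfb L A (fun x => ¬ P x) :=
  Set.Definable.compl hP

theorem Dfb.imp {P Q : (α → M) → Prop} (hP : Dfb L A P) (hQ : Dfb L A Q) :
    Dfb L A (fun x => P x → Q x) := by
  simpa only [imp_iff_not_or] using hP.not.or hQ

theorem Dfb.comp {β : Type} {P : (α → M) → Prop} (hP : Dfb L A P) (f : α → β) :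
    Dfb L A (fun x : β → M => P (x ∘ f)) :=
  Set.Definable.preimage_comp f hP

theorem Dfb.ex {P : (α → M) → M → Prop}
    (h : Dfb L A (fun x : α ⊕ Fin 1 → M => P (fun i => x (Sum.inl i)) (x (Sum.inr 0)))) :
    Dfb L A (fun x => ∃ y, P x y) := by
  have := Set.Definable.image_comp_sumInl_fin 1 h
  refine Eq.mp ?_ this
  unfold Dfb
  congr 1
  ext x
  constructor
  · rintro ⟨z, hz, rfl⟩
    exact ⟨_, hz⟩
  · rintro ⟨y, hy⟩
    exact ⟨Sum.elim x (fun _ => y), hy, rfl⟩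

theorem Dfb.all {P : (α → M) → M → Prop}
    (h : Dfb L A (fun x : α ⊕ Fin 1 → M => P (fun i => x (Sum.inl i)) (x (Sum.inr 0)))) :
    Dfb L A (fun x => ∀ y, P x y) := by
  have := (Dfb.ex (P := fun x y => ¬ P x y) h.not).not
  simpa only [not_exists, not_not] using this

theorem Dfb.eq_const (i : α) {a : M} (ha : a ∈ A) : Dfb L A (fun x : α → M => x i = a) := by
  have := Set.Definable.singleton_of_mem (L := L) ha
  exact Set.Definable.preimage_comp (fun _ : Fin 1 => i) this

theorem Dfb.const {P : (α → M) → M → Prop} {a : M} (ha : a ∈ A)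
    (h : Dfb L A (fun x : α ⊕ Fin 1 → M => P (fun i => x (Sum.inl i)) (x (Sum.inr 0)))) :
    Dfb L A (fun x => P x a) := by
  have := Dfb.ex (P := fun x y => y = a ∧ P x y) ((Dfb.eq_const _ ha).and h)
  simpa using this

theorem D1.rel {P : M → Prop} (hP : D1 L A P) (i : α) : Dfb L A (fun x : α → M => P (x i)) :=
  Dfb.comp hP (fun _ => i)

theorem D2.rel {R : M → M → Prop} (hR : D2 L A R) (i j : α) :
    Dfb L A (fun x : α → M => R (x i) (x j)) :=
  Dfb.comp hR ![i, j]

end Dfb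

/-- Definably complete locally o-minimal structures, presented through the germs of definable
sets. -/
structure LOM (L : FirstOrder.Language.{v, w}) (M : Type u) [LinearOrder M] [L.Structure M] :
    Prop where
  dense : ∀ a b : M, a < b → ∃ c, a < c ∧ c < b
  noMax : ∀ a : M, ∃ b, a < b
  noMin : ∀ a : M, ∃ b, b < a
  lt_def : D2 L (∅ : Set M) (fun a b => a < b)
  right : ∀ P : M → Prop, D1 L univ P → ∀ a, ∃ b, a < b ∧
    ((∀ x, a < x → x < b → P x) ∨ (∀ x, a < x → x < b → ¬ P x))
  left : ∀ P : M → Prop, D1 L univ P → ∀ a, ∃ b, b < a ∧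
    ((∀ x, b < x → x < a → P x) ∨ (∀ x, b < x → x < a → ¬ P x))
  inf : ∀ P : M → Prop, D1 L univ P → (∃ x, P x) → (∃ e, ∀ x, P x → e ≤ x) →
    ∃ s, (∀ x, P x → s ≤ x) ∧ ∀ e, (∀ x, P x → e ≤ x) → e ≤ s
  sup : ∀ P : M → Prop, D1 L univ P → (∃ x, P x) → (∃ e, ∀ x, P x → x ≤ e) →
    ∃ s, (∀ x, P x → x ≤ s) ∧ ∀ e, (∀ x, P x → x ≤ e) → s ≤ e

/-- A predicate containing no nonempty open interval. -/
def Thin {M : Type u} [LinearOrder M] (P : M → Prop) : Prop :=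
  ∀ a b, a < b → ∃ x, a < x ∧ x < b ∧ ¬ P x

section Local

variable {L : FirstOrder.Language.{v, w}} {M : Type u} [LinearOrder M] [L.Structure M]

theorem LOM.dual (h : LOM L M) :
    @LOM L Mᵒᵈ _ (inferInstanceAs (L.Structure M)) := by
  let : L.Structure Mᵒᵈ := inferInstanceAs (L.Structure M)
  exact
  { dense := fun a b hab => by
      obtain ⟨c, h1, h2⟩ := h.dense _ _ hab
      exact ⟨c, h2, h1⟩
    noMax := h.noMin
    noMin := h.noMax
    lt_def := h.lt_def.rel 1 0
    right := fun P hP a => by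
      obtain ⟨b, h1, h2⟩ := h.left P hP a
      exact ⟨b, h1, h2.imp (fun h x hx hy => h x hy hx) (fun h x hx hy => h x hy hx)⟩
    left := fun P hP a => by
      obtain ⟨b, h1, h2⟩ := h.right P hP a
      exact ⟨b, h1, h2.imp (fun h x hx hy => h x hy hx) (fun h x hx hy => h x hy hx)⟩
    inf := h.sup
    sup := h.inf }

theorem LOM.lt (h : LOM L M) {A : Set M} {α : Type} (i j : α) :
    Dfb L A (fun x : α → M => x i < x j) :=
  (h.lt_def.rel i j).mono (Set.empty_subset _)

theorem LOM.le (h : LOM L M) {A : Set M} {α : Type} (i j : α) :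
    Dfb L A (fun x : α → M => x i ≤ x j) := by
  simpa only [not_lt] using (h.lt (A := A) j i).not

theorem Thin.mono {P Q : M → Prop} (hQ : Thin Q) (hPQ : ∀ x, P x → Q x) : Thin P := by
  intro a b hab
  obtain ⟨x, h1, h2, h3⟩ := hQ a b hab
  exact ⟨x, h1, h2, fun h => h3 (hPQ x h)⟩

theorem Thin.dual {P : M → Prop} (hP : Thin P) : @Thin Mᵒᵈ _ P := by
  intro a b hab
  obtain ⟨x, h1, h2, h3⟩ := hP b a hab
  exact ⟨x, h2, h1, h3⟩

theorem not_thin {P : M → Prop} : ¬ Thin P ↔ ∃ a b, a < b ∧ ∀ x, a < x → x < b → P x := by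
  simp [Thin]

theorem LOM.thin_or (h : LOM L M) {P Q : M → Prop} (hPd : D1 L univ P)
    (hP : Thin P) (hQ : Thin Q) : Thin (fun x => P x ∨ Q x) := by
  by_contra hcon
  obtain ⟨a, b, hab, hx⟩ := not_thin.1 hcon
  obtain ⟨c, hc, h1 | h1⟩ := h.right P hPd a
  · obtain ⟨x, hx1, hx2, hx3⟩ := hP a c hc
    exact hx3 (h1 x hx1 hx2)
  · obtain ⟨x, hx1, hx2, hx3⟩ := hQ a (min b c) (lt_min hab hc)
    rw [lt_min_iff] at hx2
    exact (hx x hx1 hx2.1).elim (h1 x hx1 hx2.2) hx3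

theorem LOM.thin_min (h : LOM L M) {P : M → Prop} (hPd : D1 L univ P) (hP : Thin P)
    (hne : ∃ x, P x) (hb : ∃ e, ∀ x, P x → e ≤ x) : ∃ s, P s ∧ ∀ x, P x → s ≤ x := by
  obtain ⟨s, hs1, hs2⟩ := h.inf P hPd hne hb
  refine ⟨s, ?_, hs1⟩
  by_contra hPs
  obtain ⟨b, hsb, h1 | h1⟩ := h.right P hPd s
  · obtain ⟨x, hx1, hx2, hx3⟩ := hP s b hsb
    exact hx3 (h1 x hx1 hx2)
  · refine absurd (hs2 b fun x hx => ?_) (not_le.2 hsb)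
    by_contra hxb
    exact h1 x (lt_of_le_of_ne (hs1 x hx) (by rintro rfl; exact hPs hx)) (not_le.1 hxb) hx

theorem LOM.thin_max (h : LOM L M) {P : M → Prop} (hPd : D1 L univ P) (hP : Thin P)
    (hne : ∃ x, P x) (hb : ∃ e, ∀ x, P x → x ≤ e) : ∃ s, P s ∧ ∀ x, P x → x ≤ s :=
  let : L.Structure Mᵒᵈ := inferInstanceAs (L.Structure M)
  LOM.thin_min (M := Mᵒᵈ) h.dual hPd hP.dual hne hb

/-- If `R` is a definable preorder all of whose truncated sections are thin, then `R` is
strictly decreasing near the right of every point. -/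
theorem LOM.records (h : LOM L M) {R : M → M → Prop} (hR : D2 L univ R) {p q : M}
    (hrefl : ∀ c, p < c → c < q → R c c)
    (htrans : ∀ a b c, p < a → a ≤ b → b ≤ c → c < q → R a b → R b c → R a c)
    (hthin : ∀ c, p < c → c < q → Thin (fun t => (p < t ∧ t ≤ c) ∧ R t c))
    {x₀ : M} (hp : p < x₀) (hq : x₀ < q) :
    ∃ e, x₀ < e ∧ e ≤ q ∧ ∀ c t, x₀ < t → t < c → c < e → ¬ R t c := by
  have hrec : D1 L univ (fun c => ∀ t, x₀ < t → t < c → ¬ R t c) := by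
    refine Dfb.const (P := fun c x => ∀ t, x < t → t < c 0 → ¬ R t (c 0)) (mem_univ x₀) ?_
    exact .all <| .imp (h.lt _ _) <| .imp (h.lt _ _) (hR.rel _ _).not
  obtain ⟨b, hb, h1 | h1⟩ := h.right _ hrec x₀
  · refine ⟨min b q, lt_min hb hq, min_le_right _ _, fun c t ht htc hc => ?_⟩
    exact h1 c (ht.trans htc) (hc.trans_le (min_le_left _ _)) t ht htc
  · obtain ⟨c, hc1, hc2⟩ := h.dense _ _ (lt_min hb hq)
    rw [lt_min_iff] at hc2
    have hE : D1 L univ (fun t => (x₀ < t ∧ t ≤ c) ∧ R t c) := by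
      refine Dfb.const (P := fun t x => (x < t 0 ∧ t 0 ≤ c) ∧ R (t 0) c) (mem_univ x₀) ?_
      refine Dfb.const (P := fun t c => (t _ < t (Sum.inl 0) ∧ t (Sum.inl 0) ≤ c) ∧
        R (t (Sum.inl 0)) c) (mem_univ c) ?_
      exact .and (.and (h.lt _ _) (h.le _ _)) (hR.rel _ _)
    obtain ⟨m, ⟨⟨hm1, hm2⟩, hm3⟩, hm4⟩ := h.thin_min hE
      ((hthin c (hp.trans hc1) hc2.2).mono fun t ht => ⟨⟨hp.trans ht.1.1, ht.1.2⟩, ht.2⟩)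
      ⟨c, ⟨hc1, le_rfl⟩, hrefl c (hp.trans hc1) hc2.2⟩ ⟨x₀, fun x hx => hx.1.1.le⟩
    refine absurd (fun t ht htm hR' => ?_) (h1 m hm1 (hm2.trans_lt hc2.1))
    refine absurd (hm4 t ⟨⟨ht, htm.le.trans hm2⟩, ?_⟩) (not_le.2 htm)
    exact htrans t m c (hp.trans ht) htm.le hm2 hc2.2 hR' hm3

/-- A definable total preorder on an open interval has a section that is not thin. -/
theorem LOM.total_preorder (h : LOM L M) {R : M → M → Prop} (hR : D2 L univ R) {p q : M}
    (hpq : p < q)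
    (htotal : ∀ a b, p < a → a < q → p < b → b < q → R a b ∨ R b a)
    (htrans : ∀ a b c, p < a → a ≤ b → b ≤ c → c < q → R a b → R b c → R a c)
    (hthin : ∀ c, p < c → c < q → Thin (fun t => (p < t ∧ t < q) ∧ R t c)) : False := by
  obtain ⟨x₀, hp, hq⟩ := h.dense _ _ hpq
  obtain ⟨e, he, heq, hrec⟩ := h.records hR (fun c hc hc' => (htotal c c hc hc' hc hc').elim id id)
    htrans (fun c hc hc' => (hthin c hc hc').mono
      fun t ht => ⟨⟨ht.1.1, ht.1.2.trans_lt hc'⟩, ht.2⟩) hp hq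
  obtain ⟨t, ht, hte⟩ := h.dense _ _ he
  obtain ⟨c, hc1, hc2, hc3⟩ := hthin t (hp.trans ht) (hte.trans_le heq) t e hte
  have hpc := (hp.trans ht).trans hc1
  have hcq := hc2.trans_le heq
  exact hc3 ⟨⟨hpc, hcq⟩, (htotal t c (hp.trans ht) (hte.trans_le heq) hpc hcq).resolve_left
    (hrec c t ht hc1 hc2)⟩

theorem LOM.not_cover_above (h : LOM L M) {F : M → M → Prop} (hF : D2 L univ F)
    {D : M → Prop} (hDd : D1 L univ D) (hD : Thin D) {p q z : M} (hpq : p < q)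
    (hcov : ∀ x, p < x → x < q → ∃ d, (z ≤ d ∧ D d) ∧ F x d)
    (hthin : ∀ d, D d → Thin (fun x => (p < x ∧ x < q) ∧ F x d)) : False := by
  let G : M → M → Prop := fun x t => ∃ d, ((z ≤ d ∧ d ≤ t) ∧ D d) ∧ F x d
  have hG : D2 L univ G := by
    refine Dfb.const (P := fun x z => ∃ d, ((z ≤ d ∧ d ≤ x 1) ∧ D d) ∧ F (x 0) d) (mem_univ z) ?_
    exact .ex <| .and (.and (.and (h.le _ _) (h.le _ _)) (hDd.rel _)) (hF.rel _ _)
  have hGsec : ∀ t, D1 L univ (fun x => (p < x ∧ x < q) ∧ G x t) := fun t => by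
    refine Dfb.const (P := fun x t => (p < x 0 ∧ x 0 < q) ∧ G (x 0) t) (mem_univ t) ?_
    refine Dfb.const (P := fun x p => (p < x (Sum.inl 0) ∧ x (Sum.inl 0) < q) ∧
      G (x (Sum.inl 0)) (x (Sum.inr 0))) (mem_univ p) ?_
    refine Dfb.const (P := fun x q => (x _ < x (Sum.inl (Sum.inl 0)) ∧ x (Sum.inl (Sum.inl 0)) < q)
      ∧ G (x (Sum.inl (Sum.inl 0))) (x (Sum.inl (Sum.inr 0)))) (mem_univ q) ?_
    exact .and (.and (h.lt _ _) (h.lt _ _)) (hG.rel _ _)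
  have hFsec : ∀ t, D1 L univ (fun x => (p < x ∧ x < q) ∧ F x t) := fun t => by
    refine Dfb.const (P := fun x t => (p < x 0 ∧ x 0 < q) ∧ F (x 0) t) (mem_univ t) ?_
    refine Dfb.const (P := fun x p => (p < x (Sum.inl 0) ∧ x (Sum.inl 0) < q) ∧
      F (x (Sum.inl 0)) (x (Sum.inr 0))) (mem_univ p) ?_
    refine Dfb.const (P := fun x q => (x _ < x (Sum.inl (Sum.inl 0)) ∧ x (Sum.inl (Sum.inl 0)) < q)
      ∧ F (x (Sum.inl (Sum.inl 0))) (x (Sum.inl (Sum.inr 0)))) (mem_univ q) ?_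
    exact .and (.and (h.lt _ _) (h.lt _ _)) (hF.rel _ _)
  have hbad : D1 L univ (fun t => (z ≤ t ∧ D t) ∧ ∃ a, ∃ b, a < b ∧
      ∀ x, a < x → x < b → (p < x ∧ x < q) ∧ G x t) := by
    refine Dfb.const (P := fun t z => (z ≤ t 0 ∧ D (t 0)) ∧ ∃ a, ∃ b, a < b ∧
      ∀ x, a < x → x < b → (p < x ∧ x < q) ∧ G x (t 0)) (mem_univ z) ?_
    refine Dfb.const (P := fun t p => (t _ ≤ t (Sum.inl 0) ∧ D (t (Sum.inl 0))) ∧ ∃ a, ∃ b, a < b ∧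
      ∀ x, a < x → x < b → (p < x ∧ x < q) ∧ G x (t (Sum.inl 0))) (mem_univ p) ?_
    refine Dfb.const (P := fun t q => (t _ ≤ t (Sum.inl (Sum.inl 0)) ∧ D (t (Sum.inl (Sum.inl 0))))
      ∧ ∃ a, ∃ b, a < b ∧ ∀ x, a < x → x < b → (t _ < x ∧ x < q) ∧ G x (t (Sum.inl (Sum.inl 0))))
      (mem_univ q) ?_
    exact .and (.and (h.le _ _) (hDd.rel _)) <| .ex <| .ex <| .and (h.lt _ _) <| .all <|
      .imp (h.lt _ _) <| .imp (h.lt _ _) <| .and (.and (h.lt _ _) (h.lt _ _)) (hG.rel _ _)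
  have hGD : ∀ t, z ≤ t → D t → Thin (fun x => (p < x ∧ x < q) ∧ G x t) := by
    by_contra! hcon
    obtain ⟨t, hzt, hDt, hnt⟩ := hcon
    obtain ⟨t₀, ⟨⟨hzt₀, hDt₀⟩, hnt₀⟩, hmin⟩ := h.thin_min hbad (hD.mono fun x hx => hx.1.2)
      ⟨t, ⟨hzt, hDt⟩, not_thin.1 hnt⟩ ⟨z, fun x hx => hx.1.1⟩
    refine not_thin.2 hnt₀ ?_
    by_cases hprev : ∃ d, (z ≤ d ∧ d < t₀) ∧ D d
    · have hprevd : D1 L univ (fun d => (z ≤ d ∧ d < t₀) ∧ D d) := by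
        refine Dfb.const (P := fun d z => (z ≤ d 0 ∧ d 0 < t₀) ∧ D (d 0)) (mem_univ z) ?_
        refine Dfb.const (P := fun d t => (d _ ≤ d (Sum.inl 0) ∧ d (Sum.inl 0) < t) ∧
          D (d (Sum.inl 0))) (mem_univ t₀) ?_
        exact .and (.and (h.le _ _) (h.lt _ _)) (hDd.rel _)
      obtain ⟨t₁, ⟨⟨hzt₁, hlt⟩, hDt₁⟩, hmax⟩ := h.thin_max hprevd (hD.mono fun x hx => hx.2) hprev
        ⟨t₀, fun x hx => hx.1.2.le⟩
      have hG₁ : Thin (fun x => (p < x ∧ x < q) ∧ G x t₁) := by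
        by_contra hcon
        exact absurd (hmin t₁ ⟨⟨hzt₁, hDt₁⟩, not_thin.1 hcon⟩) (not_le.2 hlt)
      refine (h.thin_or (hGsec t₁) hG₁ (hthin t₀ hDt₀)).mono ?_
      rintro x ⟨hx, d, ⟨⟨hzd, hdt⟩, hDd'⟩, hxd⟩
      rcases hdt.eq_or_lt with rfl | hlt'
      · exact Or.inr ⟨hx, hxd⟩
      · exact Or.inl ⟨hx, d, ⟨⟨hzd, hmax d ⟨⟨hzd, hlt'⟩, hDd'⟩⟩, hDd'⟩, hxd⟩
    · refine (hthin t₀ hDt₀).mono ?_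
      rintro x ⟨hx, d, ⟨⟨hzd, hdt⟩, hDd'⟩, hxd⟩
      rcases hdt.eq_or_lt with rfl | hlt'
      · exact ⟨hx, hxd⟩
      · exact absurd ⟨d, ⟨hzd, hlt'⟩, hDd'⟩ hprev
  have hGmono : ∀ x t t', t ≤ t' → G x t → G x t' := by
    rintro x t t' htt' ⟨d, ⟨⟨hzd, hdt⟩, hDd'⟩, hxd⟩
    exact ⟨d, ⟨⟨hzd, hdt.trans htt'⟩, hDd'⟩, hxd⟩
  refine h.total_preorder (R := fun x' x => ∀ t, G x t → G x' t) ?_ hpq ?_ ?_ ?_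
  · exact .all <| .imp (hG.rel _ _) (hG.rel _ _)
  · intro a b _ _ _ _
    by_contra! hcon
    obtain ⟨⟨t, h1, h2⟩, ⟨t', h3, h4⟩⟩ := hcon
    rcases le_total t t' with hle | hle
    · exact h4 (hGmono _ _ _ hle h1)
    · exact h2 (hGmono _ _ _ hle h3)
  · exact fun a b c _ _ _ _ h1 h2 t ht => h1 t (h2 t ht)
  · intro c hc hc'
    obtain ⟨d, ⟨hzd, hDd'⟩, hcd⟩ := hcov c hc hc'
    exact (hGD d hzd hDd').mono fun x hx => ⟨hx.1, hx.2 d ⟨d, ⟨⟨hzd, le_rfl⟩, hDd'⟩, hcd⟩⟩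

/-- An open interval is not a union of thin sets definably indexed by a thin set. -/
theorem LOM.not_cover (h : LOM L M) {F : M → M → Prop} (hF : D2 L univ F)
    {D : M → Prop} (hDd : D1 L univ D) (hD : Thin D) {p q : M} (hpq : p < q)
    (hcov : ∀ x, p < x → x < q → ∃ d, D d ∧ F x d)
    (hthin : ∀ d, D d → Thin (fun x => (p < x ∧ x < q) ∧ F x d)) : False := by
  have habove : D1 L univ (fun x => ∃ d, (p ≤ d ∧ D d) ∧ F x d) := by
    refine Dfb.const (P := fun x p => ∃ d, (p ≤ d ∧ D d) ∧ F (x 0) d) (mem_univ p) ?_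
    exact .ex <| .and (.and (h.le _ _) (hDd.rel _)) (hF.rel _ _)
  obtain ⟨b, hb, h1 | h1⟩ := h.right _ habove p
  · exact h.not_cover_above hF hDd hD (lt_min hb hpq)
      (fun x hx hx' => h1 x hx (lt_min_iff.1 hx').1)
      (fun d hd => (hthin d hd).mono fun x hx => ⟨⟨hx.1.1, (lt_min_iff.1 hx.1.2).2⟩, hx.2⟩)
  · let : L.Structure Mᵒᵈ := inferInstanceAs (L.Structure M)
    obtain ⟨e, hpe, heb, heq⟩ : ∃ e, p < e ∧ e ≤ b ∧ e ≤ q :=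
      ⟨min b q, lt_min hb hpq, min_le_left _ _, min_le_right _ _⟩
    refine LOM.not_cover_above (M := Mᵒᵈ) h.dual hF hDd hD.dual (p := e) (q := p) (z := p)
      hpe (fun x hx hx' => ?_) (fun d hd => ?_)
    · obtain ⟨d, hDd', hd⟩ := hcov x hx' (lt_of_lt_of_le (α := M) hx heq)
      refine ⟨d, ⟨?_, hDd'⟩, hd⟩
      exact (not_le.1 fun hpd => h1 x hx' (lt_of_lt_of_le (α := M) hx heb) ⟨d, ⟨hpd, hDd'⟩, hd⟩).le
    · exact Thin.dual (M := M) ((hthin d hd).mono fun x hx =>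
        ⟨⟨hx.1.2, lt_of_lt_of_le (α := M) hx.1.1 heq⟩, hx.2⟩)

/-- Given nonempty intervals `{y | t < y ∧ U t y}` starting at `t` for every `t` in an open
interval, some `y` lies in the intervals of all `t` from an open interval. -/
theorem LOM.overlap (h : LOM L M) {U : M → M → Prop} (hU : D2 L univ U) {p q : M} (hpq : p < q)
    (hne : ∀ t, p < t → t < q → ∃ y, t < y ∧ U t y)
    (hdown : ∀ t y y', U t y → t < y' → y' ≤ y → U t y')
    (hthin : ∀ y, Thin (fun t => (p < t ∧ t < q) ∧ t < y ∧ U t y)) : False := by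
  obtain ⟨x₀, hp, hq⟩ := h.dense _ _ hpq
  obtain ⟨e, he, heq, hrec⟩ := h.records (R := fun t' t => ∀ y, t < y → U t y → U t' y)
    (.all <| .imp (h.lt _ _) <| .imp (hU.rel _ _) (hU.rel _ _)) (p := p) (q := q)
    (fun c _ _ y _ hy => hy)
    (fun a b c _ _ hbc _ h1 h2 y hy hy' => h1 y (hbc.trans_lt hy) (h2 y hy hy'))
    (fun c hc hc' => by
      obtain ⟨y, hcy, hy⟩ := hne c hc hc'
      exact (hthin y).mono fun t ht => ⟨⟨ht.1.1, ht.1.2.trans_lt hc'⟩, ht.1.2.trans_lt hcy,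
        ht.2 y hcy hy⟩) hp hq
  obtain ⟨c₀, hc₀, hc₀e⟩ := h.dense _ _ he
  obtain ⟨y₀, hcy₀, hy₀⟩ := hne c₀ (hp.trans hc₀) (hc₀e.trans_le heq)
  obtain ⟨c, hc1, hc2, hc3⟩ := hthin y₀ c₀ (min e y₀) (lt_min hc₀e hcy₀)
  rw [lt_min_iff] at hc2
  have hn := hrec c c₀ hc₀ hc1 hc2.1
  push Not at hn
  obtain ⟨y, hcy, hy, hny⟩ := hn
  have hlt : y₀ < y := not_le.1 fun hle => hny (hdown _ _ _ hy₀ (hc1.trans hcy) hle)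
  exact hc3 ⟨⟨(hp.trans hc₀).trans hc1, hc2.1.trans_le heq⟩, hc2.2, hdown _ _ _ hy hc2.2 hlt.le⟩

theorem LOM.fibers_above (h : LOM L M) {W : M → M → Prop} (hW : D2 L univ W) {p q z : M}
    (hpq : p < q)
    (hfat : ∀ x, p < x → x < q → ∃ a b, z ≤ a ∧ a < b ∧ ∀ y, a < y → y < b → W x y)
    (hthin : ∀ y, Thin (fun x => (p < x ∧ x < q) ∧ W x y)) : False := by
  let I : M → M → Prop := fun x y => ∃ a, ∃ b, ((z ≤ a ∧ a < y) ∧ y < b) ∧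
    ∀ y', a < y' → y' < b → W x y'
  have hI : D2 L univ I := by
    refine Dfb.const (P := fun x z => ∃ a, ∃ b, ((z ≤ a ∧ a < x 1) ∧ x 1 < b) ∧
      ∀ y', a < y' → y' < b → W (x 0) y') (mem_univ z) ?_
    exact .ex <| .ex <| .and (.and (.and (h.le _ _) (h.lt _ _)) (h.lt _ _)) <| .all <|
      .imp (h.lt _ _) <| .imp (h.lt _ _) (hW.rel _ _)
  have hIW : ∀ x y, I x y → W x y := by
    rintro x y ⟨a, b, ⟨⟨_, h1⟩, h2⟩, h3⟩
    exact h3 y h1 h2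
  let S : M → M → Prop := fun x l => (∀ y, y ≤ l → ¬ I x y) ∧
    ∃ b, l < b ∧ ∀ y, l < y → y < b → I x y
  have hS : D2 L univ S :=
    .and (.all <| .imp (h.le _ _) (hI.rel _ _).not) <| .ex <| .and (h.lt _ _) <| .all <|
      .imp (h.lt _ _) <| .imp (h.lt _ _) (hI.rel _ _)
  have hSle : ∀ x l l', S x l → S x l' → l' ≤ l := by
    rintro x l l' ⟨_, b, hb, h1⟩ ⟨h2, _⟩
    by_contra! hlt
    obtain ⟨y, hy1, hy2⟩ := h.dense _ _ (lt_min hb hlt)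
    rw [lt_min_iff] at hy2
    exact h2 y hy2.2.le (h1 y hy1 hy2.1)
  have hSex : ∀ x, p < x → x < q → ∃ l, S x l := by
    intro x hx hx'
    obtain ⟨a, b, hza, hab, hWx⟩ := hfat x hx hx'
    have hIx : D1 L univ (fun y => I x y) := Dfb.const (P := fun y x => I x (y 0)) (mem_univ x)
      (hI.rel _ _)
    obtain ⟨c, hc1, hc2⟩ := h.dense _ _ hab
    obtain ⟨s, hs1, hs2⟩ := h.inf _ hIx ⟨c, a, b, ⟨⟨hza, hc1⟩, hc2⟩, hWx⟩ ⟨z, by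
      rintro y ⟨a', b', ⟨⟨h1, h2⟩, _⟩, _⟩
      exact h1.trans h2.le⟩
    refine ⟨s, fun y hys hIy => ?_, ?_⟩
    · obtain rfl : y = s := le_antisymm hys (hs1 y hIy)
      obtain ⟨a', b', ⟨⟨h1, h2⟩, h3⟩, h4⟩ := hIy
      obtain ⟨d, hd1, hd2⟩ := h.dense _ _ h2
      exact absurd (hs1 d ⟨a', b', ⟨⟨h1, hd1⟩, hd2.trans h3⟩, h4⟩) (not_le.2 hd2)
    · obtain ⟨b', hb', h1 | h1⟩ := h.right _ hIx s
      · exact ⟨b', hb', h1⟩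
      · refine absurd (hs2 b' fun y hy => ?_) (not_le.2 hb')
        by_contra! hlt
        rcases (hs1 y hy).eq_or_lt with rfl | hsy
        · obtain ⟨a', b'', ⟨⟨h2, h3⟩, h4⟩, h5⟩ := hy
          obtain ⟨d, hd1, hd2⟩ := h.dense _ _ h3
          exact absurd (hs1 d ⟨a', b'', ⟨⟨h2, hd1⟩, hd2.trans h4⟩, h5⟩) (not_le.2 hd2)
        · exact h1 y hsy hlt hy
  by_cases hconst : ∃ l, ¬ Thin (fun x => (p < x ∧ x < q) ∧ S x l)
  · obtain ⟨l, hl⟩ := hconst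
    obtain ⟨p', q', hpq', hl⟩ := not_thin.1 hl
    let U : M → M → Prop := fun x y => ∀ y', l < y' → y' ≤ y → W x y'
    have hU : D2 L univ U := by
      refine Dfb.const (P := fun x l => ∀ y', l < y' → y' ≤ x 1 → W (x 0) y') (mem_univ l) ?_
      exact .all <| .imp (h.lt _ _) <| .imp (h.le _ _) (hW.rel _ _)
    refine h.total_preorder (R := fun x' x => ∀ y, l < y → U x y → U x' y) ?_ hpq' ?_ ?_ ?_
    · refine Dfb.const (P := fun x l => ∀ y, l < y → U (x 1) y → U (x 0) y) (mem_univ l) ?_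
      exact .all <| .imp (h.lt _ _) <| .imp (hU.rel _ _) (hU.rel _ _)
    · intro a b _ _ _ _
      by_contra! hcon
      obtain ⟨⟨y, _, h1, h2⟩, ⟨y', _, h3, h4⟩⟩ := hcon
      rcases le_total y y' with hle | hle
      · exact h2 fun w hw hwy => h3 w hw (hwy.trans hle)
      · exact h4 fun w hw hwy => h1 w hw (hwy.trans hle)
    · exact fun a b c _ _ _ _ h1 h2 y hy hUy => h1 y hy (h2 y hy hUy)
    · intro c hc hc'
      obtain ⟨_, b, hlb, hb⟩ := (hl c hc hc').2
      obtain ⟨y, hy1, hy2⟩ := h.dense _ _ hlb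
      refine (hthin y).mono fun x hx => ⟨(hl x hx.1.1 hx.1.2).1, ?_⟩
      exact hx.2 y hy1 (fun w hw hwy => hIW _ _ (hb w hw (hwy.trans_lt hy2))) y hy1 le_rfl
  · push Not at hconst
    let Q : M → M → Prop := fun l x => (p < x ∧ x < q) ∧ S x l
    have hQ : D2 L univ Q := by
      refine Dfb.const (P := fun l p => (p < l 1 ∧ l 1 < q) ∧ S (l 1) (l 0)) (mem_univ p) ?_
      refine Dfb.const (P := fun l q => (l (Sum.inr 0) < l (Sum.inl 1) ∧ l (Sum.inl 1) < q) ∧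
        S (l (Sum.inl 1)) (l (Sum.inl 0))) (mem_univ q) ?_
      exact .and (.and (h.lt _ _) (h.lt _ _)) (hS.rel _ _)
    have hfat' : ¬ Thin (fun l => ∃ x, Q l x) := fun hcon =>
      h.not_cover (F := S) hS (D := fun l => ∃ x, Q l x) (.ex (hQ.rel _ _)) hcon hpq
        (fun x hx hx' => (hSex x hx hx').imp fun l hl => ⟨⟨x, ⟨hx, hx'⟩, hl⟩, hl⟩)
        fun d _ => hconst d
    obtain ⟨p', q', hpq', hK⟩ := not_thin.1 hfat'
    let U : M → M → Prop := fun t y => ∃ x, Q t x ∧ ∀ y', t < y' → y' ≤ y → W x y'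
    have hU : D2 L univ U :=
      .ex <| .and (hQ.rel _ _) <| .all <| .imp (h.lt _ _) <| .imp (h.le _ _) (hW.rel _ _)
    refine h.overlap hU hpq' ?_ ?_ ?_
    · intro t ht ht'
      obtain ⟨x, hx⟩ := hK t ht ht'
      obtain ⟨_, b, hlb, hb⟩ := hx.2
      obtain ⟨y, hy1, hy2⟩ := h.dense _ _ hlb
      exact ⟨y, hy1, x, hx, fun w hw hwy => hIW _ _ (hb w hw (hwy.trans_lt hy2))⟩
    · rintro t y y' ⟨x, hx, hxy⟩ _ hle
      exact ⟨x, hx, fun w hw hwy => hxy w hw (hwy.trans hle)⟩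
    · intro y
      by_contra hcon
      obtain ⟨a, b, hab, hy⟩ := not_thin.1 hcon
      refine h.not_cover hQ (D := fun x => (p < x ∧ x < q) ∧ W x y) ?_ (hthin y) hab ?_ ?_
      · refine Dfb.const (P := fun x p => (p < x 0 ∧ x 0 < q) ∧ W (x 0) y) (mem_univ p) ?_
        refine Dfb.const (P := fun x q => (x (Sum.inr 0) < x (Sum.inl 0) ∧ x (Sum.inl 0) < q) ∧
          W (x (Sum.inl 0)) y) (mem_univ q) ?_
        refine Dfb.const (P := fun x y => (x (Sum.inl (Sum.inr 0)) < x (Sum.inl (Sum.inl 0)) ∧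
          x (Sum.inl (Sum.inl 0)) < x (Sum.inr 0)) ∧ W (x (Sum.inl (Sum.inl 0))) y) (mem_univ y) ?_
        exact .and (.and (h.lt _ _) (h.lt _ _)) (hW.rel _ _)
      · intro t ht ht'
        obtain ⟨_, hty, x, hx, hxy⟩ := hy t ht ht'
        exact ⟨x, ⟨hx.1, hxy y hty le_rfl⟩, hx⟩
      · intro x _ a' b' hab'
        by_contra! hcon'
        obtain ⟨l, hl1, hl2⟩ := h.dense _ _ hab'
        obtain ⟨l', hl'1, hl'2⟩ := h.dense _ _ hl2
        exact absurd (hSle x l l' (hcon' l hl1 hl2).2.2 (hcon' l' (hl1.trans hl'1) hl'2).2.2)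
          (not_le.2 hl'1)

/-- If all fibers of a definable plane set over an open interval of the first axis contain
intervals, then some section over the second axis contains an interval. -/
theorem LOM.fibers (h : LOM L M) {W : M → M → Prop} (hW : D2 L univ W) {p q : M} (hpq : p < q)
    (hfat : ∀ x, p < x → x < q → ¬ Thin (W x))
    (hthin : ∀ y, Thin (fun x => W x y)) : False := by
  have habove : D1 L univ (fun x => ∃ a, ∃ b, p ≤ a ∧ a < b ∧ ∀ y, a < y → y < b → W x y) := by
    refine Dfb.const (P := fun x p => ∃ a, ∃ b, p ≤ a ∧ a < b ∧ ∀ y, a < y → y < b → W (x 0) y)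
      (mem_univ p) ?_
    exact .ex <| .ex <| .and (h.le _ _) <| .and (h.lt _ _) <| .all <|
      .imp (h.lt _ _) <| .imp (h.lt _ _) (hW.rel _ _)
  obtain ⟨b, hb, h1 | h1⟩ := h.right _ habove p
  · exact h.fibers_above hW (lt_min hb hpq) (fun x hx hx' => h1 x hx (lt_min_iff.1 hx').1)
      fun y => (hthin y).mono fun x hx => hx.2
  · let : L.Structure Mᵒᵈ := inferInstanceAs (L.Structure M)
    obtain ⟨e, hpe, heb, heq⟩ : ∃ e, p < e ∧ e ≤ b ∧ e ≤ q :=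
      ⟨min b q, lt_min hb hpq, min_le_left _ _, min_le_right _ _⟩
    refine LOM.fibers_above (M := Mᵒᵈ) h.dual hW (p := e) (q := p) (z := p) hpe
      (fun x hx hx' => ?_) fun y => Thin.dual (M := M) ((hthin y).mono fun x hx => hx.2)
    obtain ⟨a', b', hab, hWx⟩ :=
      not_thin.1 (hfat x hx' (lt_of_lt_of_le (α := M) hx heq))
    refine ⟨b', a', ?_, hab, fun y hy hy' => hWx y hy' hy⟩
    change b' ≤ p
    by_contra hlt
    rw [not_le] at hlt
    exact h1 x hx' (lt_of_lt_of_le (α := M) hx heb) ⟨max a' p, b', le_max_right _ _,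
      max_lt hab hlt, fun y hy hy' => hWx y ((le_max_left _ _).trans_lt hy) hy'⟩

end Local

section Closure

variable {L : FirstOrder.Language.{v, w}} {M : Type u} [L.Structure M]

theorem Dfb.exists_of_insert {α : Type} {C : Set M} {b : M} {P : (α → M) → Prop}
    (hP : Dfb L (insert b C) P) : ∃ S : (α → M) → M → Prop,
      Dfb L C (fun x : α ⊕ Fin 1 → M => S (fun i => x (Sum.inl i)) (x (Sum.inr 0))) ∧
      ∀ x, P x ↔ S x b := by
  classical
  obtain ⟨φ, hφ⟩ := Set.definable_iff_exists_formula_sum.1 hP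
  refine ⟨fun x y => φ.Realize
    (Sum.elim (fun c : ↑(insert b C) => if (c : M) = b then y else c) x), ?_, fun x => ?_⟩
  · refine Set.definable_iff_exists_formula_sum.2 ⟨φ.relabel (Sum.elim
      (fun c : ↑(insert b C) => if hc : (c : M) = b then Sum.inr (Sum.inr 0) else
        Sum.inl ⟨c, c.2.resolve_left hc⟩) (fun i => Sum.inr (Sum.inl i))), ?_⟩
    ext x
    simp only [Set.mem_ofPred_eq, Formula.realize_relabel]
    refine iff_of_eq (congrArg _ (funext fun j => ?_))
    rcases j with c | i
    · by_cases hc : (c : M) = b <;> simp [hc]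
    · simp
  · have : P x ↔ x ∈ {x | P x} := Iff.rfl
    rw [this, hφ, Set.mem_ofPred_eq]
    refine iff_of_eq (congrArg _ (funext fun j => ?_))
    rcases j with c | i
    · by_cases hc : (c : M) = b <;> simp [hc]
    · simp

theorem Dfb.consts {α β : Type} {C : Set M} {P : (α ⊕ β → M) → Prop}
    (hP : Dfb L C P) {a : β → M} (ha : ∀ j, a j ∈ C) :
    Dfb L C (fun x : α → M => P (Sum.elim x a)) := by
  obtain ⟨φ, hφ⟩ := Set.definable_iff_exists_formula_sum.1 hP
  refine Set.definable_iff_exists_formula_sum.2 ⟨φ.relabel (Sum.elim Sum.inl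
    (Sum.elim Sum.inr fun j => Sum.inl ⟨a j, ha j⟩)), ?_⟩
  ext x
  have : P (Sum.elim x a) ↔ Sum.elim x a ∈ {x | P x} := Iff.rfl
  rw [Set.mem_ofPred_eq, this, hφ, Set.mem_ofPred_eq, Set.mem_ofPred_eq, Formula.realize_relabel]
  refine iff_of_eq (congrArg _ (funext fun j => ?_))
  rcases j with c | i | j <;> simp

variable [LinearOrder M]

/-- The union of all thin sets definable over `A`. -/
def cl (L : FirstOrder.Language.{v, w}) {M : Type u} [L.Structure M] [LinearOrder M]
    (A : Set M) : Set M :=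
  {x | ∃ P : M → Prop, D1 L A P ∧ Thin P ∧ P x}

theorem cl_mono {A B : Set M} (h : A ⊆ B) : cl L A ⊆ cl L B := by
  rintro x ⟨P, h1, h2, h3⟩
  exact ⟨P, h1.mono h, h2, h3⟩

theorem LOM.subset_cl (h : LOM L M) (A : Set M) : A ⊆ cl L A := by
  intro x hx
  refine ⟨fun y => y = x, Dfb.eq_const 0 hx, fun a b hab => ?_, rfl⟩
  obtain ⟨c, hc1, hc2⟩ := h.dense _ _ hab
  obtain ⟨d, hd1, hd2⟩ := h.dense _ _ hc2
  by_cases hcx : c = x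
  · exact ⟨d, hc1.trans hd1, hd2, by rintro rfl; exact hd1.ne hcx⟩
  · exact ⟨c, hc1, hc2, hcx⟩

theorem LOM.exchange (h : LOM L M) {C : Set M} {a b : M} (ha : a ∈ cl L (insert b C))
    (hna : a ∉ cl L C) : b ∈ cl L (insert a C) := by
  obtain ⟨P, hPd, hPt, hPa⟩ := ha
  obtain ⟨S', hS', hPS'⟩ := Dfb.exists_of_insert hPd
  let S : M → M → Prop := fun x y => S' (fun _ => x) y
  have hS : D2 L C S := hS'.comp (Sum.elim (fun _ => 0) fun _ => 1)
  have hPS : ∀ x, P x ↔ S x b := fun x => hPS' fun _ => x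
  let W : M → M → Prop := fun x y => S x y ∧
    ¬ ∃ c, ∃ d, c < d ∧ ∀ x', c < x' → x' < d → S x' y
  have hW : D2 L C W := .and (hS.rel _ _) <| .not <| .ex <| .ex <| .and (h.lt _ _) <|
    .all <| .imp (h.lt _ _) <| .imp (h.lt _ _) (hS.rel _ _)
  have hWthin : ∀ y, Thin (fun x => W x y) := by
    intro y c d hcd
    by_contra! hcon
    obtain ⟨x, hx1, hx2⟩ := h.dense _ _ hcd
    exact (hcon x hx1 hx2).2 ⟨c, d, hcd, fun x' hx' hx'' => (hcon x' hx' hx'').1⟩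
  have hWab : W a b := by
    refine ⟨(hPS a).1 hPa, ?_⟩
    rintro ⟨c, d, hcd, hx⟩
    obtain ⟨x, hx1, hx2, hx3⟩ := hPt c d hcd
    exact hx3 ((hPS x).2 (hx x hx1 hx2))
  let N : M → M → Prop := fun x y => ∃ c, ∃ d, (c < y ∧ y < d) ∧ ∀ y', c < y' → y' < d → W x y'
  have hN : D2 L C N := .ex <| .ex <| .and (.and (h.lt _ _) (h.lt _ _)) <|
    .all <| .imp (h.lt _ _) <| .imp (h.lt _ _) (hW.rel _ _)
  by_contra hb
  have hNab : N a b := by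
    by_contra hnN
    refine hb ⟨fun y => W a y ∧ ¬ N a y, ?_, ?_, hWab, hnN⟩
    · refine Dfb.const (P := fun y a => W a (y 0) ∧ ¬ N a (y 0)) (Set.mem_insert a C) ?_
      exact .and (D2.rel (Dfb.mono hW (Set.subset_insert a C)) _ _)
        (.not (D2.rel (Dfb.mono hN (Set.subset_insert a C)) _ _))
    · intro c d hcd
      by_contra! hcon
      obtain ⟨x, hx1, hx2⟩ := h.dense _ _ hcd
      exact (hcon x hx1 hx2).2 ⟨c, d, ⟨hx1, hx2⟩, fun x' hx' hx'' => (hcon x' hx' hx'').1⟩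
  have hfat : ¬ Thin (fun x => ∃ y, N x y) :=
    fun hcon => hna ⟨fun x => ∃ y, N x y, Dfb.ex (hN.rel _ _), hcon, b, hNab⟩
  obtain ⟨p, q, hpq, hfat⟩ := not_thin.1 hfat
  refine h.fibers (hW.mono (Set.subset_univ _)) hpq (fun x hx hx' => not_thin.2 ?_) hWthin
  obtain ⟨y, c, d, hcd, hy⟩ := hfat x hx hx'
  exact ⟨c, d, hcd.1.trans hcd.2, hy⟩

/-- No entry of the tuple is in the closure of the others over `C`. -/
def Indep (L : FirstOrder.Language.{v, w}) {M : Type u} [L.Structure M] [LinearOrder M]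
    (C : Set M) {d : ℕ} (a : Fin d → M) : Prop :=
  ∀ i, a i ∉ cl L (C ∪ a '' {i}ᶜ)

theorem LOM.indep_insert (h : LOM L M) {C : Set M} {d : ℕ} {a : Fin d → M} (ha : Indep L C a)
    {e : M} (he : e ∉ cl L (C ∪ Set.range a)) : Indep L (insert e C) a := by
  intro i hi
  rw [Set.insert_union] at hi
  refine he (cl_mono ?_ (h.exchange hi (ha i)))
  refine Set.insert_subset (Or.inr ⟨i, rfl⟩) (Set.union_subset_union_right _ ?_)
  exact Set.image_subset_range _ _

theorem LOM.indep_cons (h : LOM L M) {C : Set M} {d : ℕ} {a : Fin d → M} (ha : Indep L C a)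
    {e : M} (he : e ∉ cl L (C ∪ Set.range a)) :
    Indep L C (Fin.cons e a : Fin (d + 1) → M) := by
  intro i
  induction i using Fin.cases with
  | zero =>
    rw [Fin.cons_zero]
    refine fun hcon => he (cl_mono (Set.union_subset_union_right _ ?_) hcon)
    rintro _ ⟨j, hj, rfl⟩
    obtain ⟨k, rfl⟩ := Fin.exists_succ_eq.2 hj
    exact ⟨k, by simp⟩
  | succ i =>
    rw [Fin.cons_succ]
    refine fun hcon => h.indep_insert ha he i (cl_mono ?_ hcon)
    rintro x (hx | ⟨j, hj, rfl⟩)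
    · exact Or.inl (Or.inr hx)
    · induction j using Fin.cases with
      | zero => exact Or.inl (Or.inl (by simp))
      | succ j => exact Or.inr ⟨j, fun hji => hj (congrArg Fin.succ hji), by simp⟩

theorem Indep.tail {C : Set M} {d : ℕ} {v : Fin (d + 1) → M} (hv : Indep L C v) :
    Indep L C (Fin.tail v) := by
  intro i hi
  refine hv i.succ (cl_mono (Set.union_subset_union_right _ ?_) hi)
  rintro _ ⟨j, hj, rfl⟩
  exact ⟨j.succ, fun hji => hj (Fin.succ_injective _ hji), rfl⟩

theorem Indep.head {C : Set M} {d : ℕ} {v : Fin (d + 1) → M} (hv : Indep L C v) :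
    v 0 ∉ cl L (C ∪ Set.range (Fin.tail v)) := by
  refine fun hi => hv 0 (cl_mono (Set.union_subset_union_right _ ?_) hi)
  rintro _ ⟨j, rfl⟩
  exact ⟨j.succ, Fin.succ_ne_zero j, rfl⟩

theorem LOM.exists_basis (h : LOM L M) {C R s₀ : Set M} (hR : R.Finite) (hs₀ : s₀ ⊆ R)
    (hind : ∀ x ∈ s₀, x ∉ cl L ((s₀ \ {x}) ∪ C)) :
    ∃ s, s₀ ⊆ s ∧ s ⊆ R ∧ (∀ x ∈ s, x ∉ cl L ((s \ {x}) ∪ C)) ∧ R ⊆ cl L (s ∪ C) := by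
  have hfin : {s | s ⊆ R ∧ ∀ x ∈ s, x ∉ cl L ((s \ {x}) ∪ C)}.Finite :=
    hR.finite_subsets.subset fun s hs => hs.1
  obtain ⟨s, hs₀s, ⟨hsR, hs⟩, hmax⟩ := hfin.exists_le_maximal ⟨hs₀, hind⟩
  refine ⟨s, hs₀s, hsR, hs, fun y hy => ?_⟩
  by_contra hcon
  have hys : y ∉ s := fun hys => hcon (h.subset_cl _ (Or.inl hys))
  refine hys (hmax ⟨Set.insert_subset hy hsR, ?_⟩ (Set.subset_insert y s) (Set.mem_insert y s))
  rintro x (rfl | hx)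
  · refine fun hx => hcon (cl_mono (Set.union_subset_union_left _ ?_) hx)
    rintro z ⟨hz | hz, hzx⟩
    · exact absurd hz hzx
    · exact hz
  · intro hcl
    refine hcon (cl_mono ?_ (h.exchange (b := y) (cl_mono ?_ hcl) (hs x hx)))
    · rintro z (rfl | hz | hz)
      · exact Or.inl hx
      · exact Or.inl hz.1
      · exact Or.inr hz
    · rintro z (⟨rfl | hz, hzx⟩ | hz)
      · exact Or.inl rfl
      · exact Or.inr (Or.inl ⟨hz, hzx⟩)
      · exact Or.inr (Or.inr hz)

theorem LOM.discl_eq_cl (h : LOM L M) [TopologicalSpace M] [OrderTopology M] (A : Set M) :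
    Paper.discl L M A = cl L A := by
  have : NoMaxOrder M := ⟨h.noMax⟩
  have : NoMinOrder M := ⟨h.noMin⟩
  ext x
  constructor
  · rintro ⟨s, hs, hsd, -, hx⟩
    refine ⟨fun y => y ∈ s, hs, ?_, hx⟩
    intro a b hab
    by_contra! hcon
    obtain ⟨c, hc1, hc2⟩ := h.dense _ _ hab
    obtain ⟨U, hU, hcU, hUs⟩ := hsd c (hcon c hc1 hc2)
    obtain ⟨l, u, hclu, hlu⟩ := mem_nhds_iff_exists_Ioo_subset.1
      ((hU.inter isOpen_Ioo).mem_nhds ⟨hcU, hc1, hc2⟩)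
    obtain ⟨d, hd1, hd2⟩ := h.dense _ _ hclu.2
    have hd := hlu ⟨hclu.1.trans hd1, hd2⟩
    have hdc : d ∈ U ∩ s := ⟨hd.1, hcon d hd.2.1 hd.2.2⟩
    rw [hUs] at hdc
    exact hd1.ne' hdc
  · rintro ⟨P, hP, hPt, hPx⟩
    have hiso : ∀ y, ∃ l u, (l < y ∧ y < u) ∧ ∀ z, l < z → z < u → P z → z = y := by
      intro y
      have hP' : D1 L univ P := hP.mono (Set.subset_univ _)
      obtain ⟨u, hu, hu'⟩ := h.right P hP' y
      obtain ⟨l, hl, hl'⟩ := h.left P hP' y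
      refine ⟨l, u, ⟨hl, hu⟩, fun z hz hz' hPz => ?_⟩
      rcases lt_trichotomy z y with hlt | heq | hlt
      · rcases hl' with hl' | hl'
        · obtain ⟨t, ht, ht', ht''⟩ := hPt l y hl
          exact absurd (hl' t ht ht') ht''
        · exact absurd hPz (hl' z hz hlt)
      · exact heq
      · rcases hu' with hu' | hu'
        · obtain ⟨t, ht, ht', ht''⟩ := hPt y u hu
          exact absurd (hu' t ht ht') ht''
        · exact absurd hPz (hu' z hlt hz')
    refine ⟨{y | P y}, hP, fun y hy => ?_, ?_, hPx⟩
    · obtain ⟨l, u, hlu, hz⟩ := hiso y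
      refine ⟨Set.Ioo l u, isOpen_Ioo, hlu, Set.eq_singleton_iff_unique_mem.2
        ⟨⟨hlu, hy⟩, fun z hz' => hz z hz'.1.1 hz'.1.2 hz'.2⟩⟩
    · rw [← isOpen_compl_iff, isOpen_iff_mem_nhds]
      intro y hy
      obtain ⟨l, u, hlu, hz⟩ := hiso y
      refine Filter.mem_of_superset (Ioo_mem_nhds hlu.1 hlu.2) fun z hz' hPz => hy ?_
      have := hz z hz'.1 hz'.2 hPz
      exact this ▸ hPz

end Closure

theorem mk_union_range_le {M : Type u} {κ : Cardinal.{u}} (hκ : Cardinal.aleph0 ≤ κ) {C : Set M}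
    (hC : Cardinal.mk C ≤ κ) {d : ℕ} (a : Fin d → M) :
    Cardinal.mk ↑(C ∪ Set.range a) ≤ κ := by
  refine (Cardinal.mk_union_le _ _).trans (Cardinal.add_le_of_le hκ hC ?_)
  exact ((Set.finite_range a).lt_aleph0).le.trans hκ

theorem mk_insert_le_of_le {M : Type u} {κ : Cardinal.{u}} (hκ : Cardinal.aleph0 ≤ κ) {C : Set M}
    (hC : Cardinal.mk C ≤ κ) (e : M) : Cardinal.mk ↑(insert e C) ≤ κ :=
  Cardinal.mk_insert_le.trans
    (Cardinal.add_le_of_le hκ hC (Cardinal.one_lt_aleph0.le.trans hκ))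

section Generic

variable {L : FirstOrder.Language.{v, w}} {M : Type u} [L.Structure M] [LinearOrder M]

theorem LOM.thin_exists_finset (h : LOM L M) {β : Type*} (t : Finset β) {P : β → M → Prop}
    (hPd : ∀ i ∈ t, D1 L univ (P i)) (hP : ∀ i ∈ t, Thin (P i)) :
    Thin (fun x => ∃ i ∈ t, P i x) := by
  classical
  induction t using Finset.induction_on with
  | empty =>
    intro a b hab
    obtain ⟨c, hc1, hc2⟩ := h.dense _ _ hab
    exact ⟨c, hc1, hc2, by simp⟩
  | insert i t _ ih =>
    refine (h.thin_or (hPd i (Finset.mem_insert_self i t)) (hP i (Finset.mem_insert_self i t))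
      (ih (fun j hj => hPd j (Finset.mem_insert_of_mem hj))
        fun j hj => hP j (Finset.mem_insert_of_mem hj))).mono fun x hx => ?_
    simpa using hx

theorem LOM.exists_notMem_cl (h : LOM L M) {κ : Cardinal.{u}} (hκ : Cardinal.aleph0 ≤ κ)
    (hs : RealizesSmallTypes L M (Order.succ κ)) {S : Set M} (hS : Cardinal.mk S ≤ κ) {a b : M}
    (hab : a < b) : ∃ x, a < x ∧ x < b ∧ x ∉ cl L S := by
  let S' : Set M := insert a (insert b S)
  have hS' : Cardinal.mk S' ≤ κ := by
    refine (Cardinal.mk_insert_le.trans (add_le_add_left Cardinal.mk_insert_le 1)).trans ?_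
    refine Cardinal.add_le_of_le hκ (Cardinal.add_le_of_le hκ hS ?_) ?_ <;>
    exact Cardinal.one_lt_aleph0.le.trans hκ
  have hdef : ∀ ψ : (L[[S']]).Formula (Fin 1), D1 L S' (fun x => ψ.Realize (fun _ => x)) := by
    intro ψ
    refine ⟨ψ, ?_⟩
    ext x
    have : (fun _ => x 0) = x := funext fun i => congrArg x (Subsingleton.elim _ _)
    simp only [Set.mem_ofPred_eq, this]
  have hgt : D1 L S' (fun x => a < x) :=
    Dfb.const (P := fun x y => y < x 0) (Set.mem_insert _ _) (h.lt _ _)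
  have hlt : D1 L S' (fun x => x < b) :=
    Dfb.const (P := fun x y => x 0 < y) (Set.mem_insert_of_mem _ (Set.mem_insert _ _)) (h.lt _ _)
  obtain ⟨v, hv⟩ := hs S' (Order.lt_succ_of_le hS')
    {ψ | Thin fun x => (a < x ∧ x < b) ∧ ¬ ψ.Realize (fun _ => x)} (fun t ht => by
      have := h.thin_exists_finset t
        (P := fun ψ x => (a < x ∧ x < b) ∧ ¬ ψ.Realize (fun _ => x))
        (fun ψ _ => Dfb.mono (.and (.and hgt hlt) (.not (hdef ψ))) (Set.subset_univ _))
        (fun ψ hψ => ht hψ) a b hab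
      obtain ⟨x, hx1, hx2, hx⟩ := this
      refine ⟨fun _ => x, fun ψ hψ => ?_⟩
      by_contra hcon
      exact hx ⟨ψ, hψ, ⟨hx1, hx2⟩, hcon⟩)
  have key : ∀ P : M → Prop, D1 L S' P → Thin (fun x => (a < x ∧ x < b) ∧ ¬ P x) → P (v 0) := by
    rintro P ⟨ψ, hψ⟩ hP
    have hψ' : ∀ x : Fin 1 → M, ψ.Realize x ↔ P (x 0) := fun x => (Set.ext_iff.1 hψ x).symm
    exact (hψ' v).1 (hv ψ (hP.mono fun x hx => by simpa only [hψ'] using hx))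
  have hthin : ∀ P : M → Prop, (∀ x, ¬ P x) → Thin P := by
    intro P hP c d hcd
    obtain ⟨x, hx1, hx2⟩ := h.dense _ _ hcd
    exact ⟨x, hx1, hx2, hP x⟩
  refine ⟨v 0, key _ hgt (hthin _ (by tauto)), key _ hlt (hthin _ (by tauto)), ?_⟩
  rintro ⟨P, hPd, hP, hPv⟩
  refine key (fun x => ¬ P x) (Dfb.not (Dfb.mono hPd ?_)) (hP.mono fun x hx => ?_) hPv
  · exact (Set.subset_insert _ _).trans (Set.subset_insert _ _)
  · exact not_not.1 hx.2

/-- Every open interval has points outside of the closure of each small set. -/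
def Avoids (L : FirstOrder.Language.{v, w}) (M : Type u) [L.Structure M] [LinearOrder M]
    (κ : Cardinal.{u}) : Prop :=
  ∀ S : Set M, Cardinal.mk S ≤ κ → ∀ a b, a < b → ∃ x, a < x ∧ x < b ∧ x ∉ cl L S

theorem LOM.exists_indep (h : LOM L M) {κ : Cardinal.{u}} (hκ : Cardinal.aleph0 ≤ κ)
    (hav : Avoids L M κ) {C : Set M} (hC : Cardinal.mk C ≤ κ) :
    ∀ {d : ℕ} (lo hi : Fin d → M), (∀ i, lo i < hi i) →
      ∃ v : Fin d → M, (∀ i, lo i < v i ∧ v i < hi i) ∧ Indep L C v := by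
  intro d
  induction d with
  | zero => exact fun lo hi _ => ⟨lo, fun i => i.elim0, fun i => i.elim0⟩
  | succ d ih =>
    intro lo hi hlh
    obtain ⟨v, hv, hvC⟩ := ih (Fin.tail lo) (Fin.tail hi) fun i => hlh i.succ
    obtain ⟨e, he1, he2, he⟩ := hav _ (mk_union_range_le hκ hC v) _ _ (hlh 0)
    exact ⟨Fin.cons e v, Fin.forall_fin_succ.2 ⟨And.intro he1 he2, hv⟩, h.indep_cons hvC he⟩

theorem LOM.exists_interval (h : LOM L M) {C : Set M} {P : M → Prop} (hP : D1 L C P) {b : M}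
    (hPb : P b) (hb : b ∉ cl L C) : ∃ c e, (c < b ∧ b < e) ∧ ∀ x, c < x → x < e → P x := by
  by_contra hcon
  refine hb ⟨fun y => P y ∧ ¬ ∃ c, ∃ e, (c < y ∧ y < e) ∧ ∀ x, c < x → x < e → P x,
    ?_, ?_, hPb, hcon⟩
  · exact .and (hP.rel _) <| .not <| .ex <| .ex <| .and (.and (h.lt _ _) (h.lt _ _)) <|
      .all <| .imp (h.lt _ _) <| .imp (h.lt _ _) (hP.rel _)
  · by_contra hfat
    obtain ⟨c, d, hcd, hall⟩ := not_thin.1 hfat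
    obtain ⟨x, hx1, hx2⟩ := h.dense _ _ hcd
    exact (hall x hx1 hx2).2 ⟨c, d, ⟨hx1, hx2⟩, fun y hy hy' => (hall y hy hy').1⟩

/-- A definable set with an independent point contains an open box. -/
theorem LOM.exists_box (h : LOM L M) {κ : Cardinal.{u}} (hκ : Cardinal.aleph0 ≤ κ)
    (hav : Avoids L M κ) : ∀ {d : ℕ} {C : Set M}, Cardinal.mk C ≤ κ →
      ∀ {Y : (Fin d → M) → Prop}, Dfb L C Y → ∀ {v : Fin d → M}, Y v → Indep L C v →
      ∃ lo hi : Fin d → M, (∀ i, lo i < hi i) ∧ ∀ x, (∀ i, lo i < x i ∧ x i < hi i) → Y x := by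
  intro d
  induction d with
  | zero =>
    intro C _ Y _ v hYv _
    exact ⟨v, v, fun i => i.elim0, fun x _ => Subsingleton.elim v x ▸ hYv⟩
  | succ d ih =>
    intro C hC Y hY v hYv hv
    have hP : D1 L (C ∪ Set.range (Fin.tail v)) (fun y => Y (Fin.cons y (Fin.tail v))) := by
      have h1 : Dfb L (C ∪ Set.range (Fin.tail v)) (fun x : Fin 1 ⊕ Fin d → M =>
          Y (x ∘ (Fin.cons (Sum.inl 0) Sum.inr : Fin (d + 1) → Fin 1 ⊕ Fin d))) :=
        (hY.mono Set.subset_union_left).comp _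
      have h2 := h1.consts (a := Fin.tail v) fun j => Or.inr ⟨j, rfl⟩
      have h3 : ∀ x : Fin 1 → M, Sum.elim x (Fin.tail v) ∘
          (Fin.cons (Sum.inl 0) Sum.inr : Fin (d + 1) → Fin 1 ⊕ Fin d) =
          Fin.cons (x 0) (Fin.tail v) := fun x => funext <| Fin.cases rfl fun i => rfl
      simp only [h3] at h2
      exact h2
    obtain ⟨c₀, e₀, ⟨hcb, hbe⟩, hsub⟩ := h.exists_interval hP
      (by rwa [Fin.cons_self_tail]) hv.head
    obtain ⟨c, hc0, hcb, hc⟩ := hav _ (mk_union_range_le hκ hC (Fin.tail v)) _ _ hcb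
    have hC' := mk_insert_le_of_le hκ hC c
    obtain ⟨e, hbe, he0, he⟩ := hav _ (mk_union_range_le hκ hC' (Fin.tail v)) _ _ hbe
    have hind := h.indep_insert (h.indep_insert hv.tail hc) he
    have hZ : Dfb L (insert e (insert c C))
        (fun x : Fin d → M => ∀ y, c < y → y < e → Y (Fin.cons y x)) := by
      refine .all <| .imp ?_ <| .imp ?_ ?_
      · exact Dfb.const (P := fun x y => y < x (Sum.inr 0))
          (Set.mem_insert_of_mem _ (Set.mem_insert _ _)) (h.lt _ _)
      · exact Dfb.const (P := fun x y => x (Sum.inr 0) < y) (Set.mem_insert _ _) (h.lt _ _)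
      · have h1 : Dfb L (insert e (insert c C)) (fun x : Fin d ⊕ Fin 1 → M =>
            Y (x ∘ (Fin.cons (Sum.inr 0) Sum.inl : Fin (d + 1) → Fin d ⊕ Fin 1))) :=
          (hY.mono ((Set.subset_insert _ _).trans (Set.subset_insert _ _))).comp _
        have h3 : ∀ x : Fin d ⊕ Fin 1 → M,
            x ∘ (Fin.cons (Sum.inr 0) Sum.inl : Fin (d + 1) → Fin d ⊕ Fin 1) =
            Fin.cons (x (Sum.inr 0)) fun i => x (Sum.inl i) :=
          fun x => funext <| Fin.cases rfl fun i => rfl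
        simpa only [h3] using h1
    obtain ⟨lo, hi, hlh, hbox⟩ := ih (mk_insert_le_of_le hκ hC' e) hZ
      (fun y hy hy' => hsub y (hc0.trans hy) (hy'.trans he0)) hind
    refine ⟨Fin.cons c lo, Fin.cons e hi, Fin.cases (hcb.trans hbe) hlh, fun x hx => ?_⟩
    have := hbox (Fin.tail x) (fun i => hx i.succ) (x 0) (hx 0).1 (hx 0).2
    rwa [Fin.cons_self_tail] at this

end Generic

section Transfer

variable {L : FirstOrder.Language.{v, w}} {M N : Type u} [L.Structure M] [L.Structure N]
  {α : Type*}

/-- Two predicates, on tuples from two structures, that are defined by one and the same formula. -/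
def UD (L : FirstOrder.Language.{v, w}) {M N : Type u} [L.Structure M] [L.Structure N]
    {α : Type*} (P : (α → M) → Prop) (Q : (α → N) → Prop) : Prop :=
  ∃ ψ : L.Formula α, (∀ x, ψ.Realize x ↔ P x) ∧ ∀ x, ψ.Realize x ↔ Q x

namespace UD

theorem base {β γ : Type*} (ψ : L.Formula (β ⊕ γ)) (f : β → α) (g : γ → α) :
    UD L (fun x : α → M => ψ.Realize (Sum.elim (fun i => x (f i)) fun i => x (g i)))
      (fun x : α → N => ψ.Realize (Sum.elim (fun i => x (f i)) fun i => x (g i))) := by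
  refine ⟨ψ.relabel (Sum.elim f g), fun x => ?_, fun x => ?_⟩ <;>
  · rw [Formula.realize_relabel]
    refine iff_of_eq (congrArg _ (funext fun j => ?_))
    rcases j with j | j <;> rfl

theorem le [L.IsOrdered] [LinearOrder M] [L.OrderedStructure M] [LinearOrder N]
    [L.OrderedStructure N] (i j : α) :
    UD L (fun x : α → M => x i ≤ x j) (fun x : α → N => x i ≤ x j) :=
  ⟨Term.le (.var (.inl i)) (.var (.inl j)), fun x => by simp [Formula.Realize],
    fun x => by simp [Formula.Realize]⟩

theorem lt [L.IsOrdered] [LinearOrder M] [L.OrderedStructure M] [LinearOrder N]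
    [L.OrderedStructure N] (i j : α) :
    UD L (fun x : α → M => x i < x j) (fun x : α → N => x i < x j) :=
  ⟨Term.lt (.var (.inl i)) (.var (.inl j)), fun x => by simp [Formula.Realize],
    fun x => by simp [Formula.Realize]⟩

theorem eq (i j : α) :
    UD L (fun x : α → M => x i = x j) (fun x : α → N => x i = x j) :=
  ⟨Term.equal (.var i) (.var j), fun x => by simp, fun x => by simp⟩

theorem not {P : (α → M) → Prop} {Q : (α → N) → Prop} :
    UD L P Q → UD L (fun x => ¬ P x) fun x => ¬ Q x := by
  rintro ⟨ψ, h1, h2⟩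
  exact ⟨∼ψ, fun x => by simp [h1], fun x => by simp [h2]⟩

theorem and {P P' : (α → M) → Prop} {Q Q' : (α → N) → Prop} :
    UD L P Q → UD L P' Q' → UD L (fun x => P x ∧ P' x) fun x => Q x ∧ Q' x := by
  rintro ⟨ψ, h1, h2⟩ ⟨ψ', h1', h2'⟩
  exact ⟨ψ ⊓ ψ', fun x => by simp [h1, h1'], fun x => by simp [h2, h2']⟩

theorem or {P P' : (α → M) → Prop} {Q Q' : (α → N) → Prop} :
    UD L P Q → UD L P' Q' → UD L (fun x => P x ∨ P' x) fun x => Q x ∨ Q' x := by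
  rintro ⟨ψ, h1, h2⟩ ⟨ψ', h1', h2'⟩
  exact ⟨ψ ⊔ ψ', fun x => by simp [h1, h1'], fun x => by simp [h2, h2']⟩

theorem imp {P P' : (α → M) → Prop} {Q Q' : (α → N) → Prop} :
    UD L P Q → UD L P' Q' → UD L (fun x => P x → P' x) fun x => Q x → Q' x := by
  rintro ⟨ψ, h1, h2⟩ ⟨ψ', h1', h2'⟩
  exact ⟨ψ.imp ψ', fun x => by simp [h1, h1'], fun x => by simp [h2, h2']⟩

theorem forall_finite {β : Type*} [Finite β] {P : β → (α → M) → Prop} {Q : β → (α → N) → Prop}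
    (h : ∀ i, UD L (P i) (Q i)) : UD L (fun x => ∀ i, P i x) fun x => ∀ i, Q i x := by
  choose ψ h1 h2 using h
  exact ⟨Formula.iInf ψ, fun x => by simp [h1], fun x => by simp [h2]⟩

theorem exs {β : Type*} [Finite β] {P : (α → M) → (β → M) → Prop} {Q : (α → N) → (β → N) → Prop}
    (h : UD L (fun x : α ⊕ β → M => P (fun i => x (.inl i)) fun i => x (.inr i))
      (fun x : α ⊕ β → N => Q (fun i => x (.inl i)) fun i => x (.inr i))) :
    UD L (fun x => ∃ y, P x y) fun x => ∃ y, Q x y := by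
  obtain ⟨ψ, h1, h2⟩ := h
  exact ⟨ψ.iExs β, fun x => by simp [h1], fun x => by simp [h2]⟩

theorem alls {β : Type*} [Finite β] {P : (α → M) → (β → M) → Prop}
    {Q : (α → N) → (β → N) → Prop}
    (h : UD L (fun x : α ⊕ β → M => P (fun i => x (.inl i)) fun i => x (.inr i))
      (fun x : α ⊕ β → N => Q (fun i => x (.inl i)) fun i => x (.inr i))) :
    UD L (fun x => ∀ y, P x y) fun x => ∀ y, Q x y := by
  obtain ⟨ψ, h1, h2⟩ := h
  exact ⟨ψ.iAlls β, fun x => by simp [h1], fun x => by simp [h2]⟩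

theorem ex {P : (α → M) → M → Prop} {Q : (α → N) → N → Prop}
    (h : UD L (fun x : α ⊕ Fin 1 → M => P (fun i => x (.inl i)) (x (.inr 0)))
      (fun x : α ⊕ Fin 1 → N => Q (fun i => x (.inl i)) (x (.inr 0)))) :
    UD L (fun x => ∃ y, P x y) fun x => ∃ y, Q x y := by
  obtain ⟨ψ, h1, h2⟩ := exs (P := fun x y => P x (y 0)) (Q := fun x y => Q x (y 0)) h
  refine ⟨ψ, fun x => (h1 x).trans ?_, fun x => (h2 x).trans ?_⟩ <;>
  exact ⟨fun ⟨y, hy⟩ => ⟨_, hy⟩, fun ⟨y, hy⟩ => ⟨fun _ => y, hy⟩⟩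

theorem all {P : (α → M) → M → Prop} {Q : (α → N) → N → Prop}
    (h : UD L (fun x : α ⊕ Fin 1 → M => P (fun i => x (.inl i)) (x (.inr 0)))
      (fun x : α ⊕ Fin 1 → N => Q (fun i => x (.inl i)) (x (.inr 0)))) :
    UD L (fun x => ∀ y, P x y) fun x => ∀ y, Q x y := by
  obtain ⟨ψ, h1, h2⟩ := alls (P := fun x y => P x (y 0)) (Q := fun x y => Q x (y 0)) h
  refine ⟨ψ, fun x => (h1 x).trans ?_, fun x => (h2 x).trans ?_⟩ <;>
  exact ⟨fun hy y => hy fun _ => y, fun hy y => hy _⟩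

theorem comp_iff {P : (α → M) → Prop} {Q : (α → N) → Prop} (h : UD L P Q) (ι : M ↪ₑ[L] N)
    (x : α → M) : P x ↔ Q (ι ∘ x) := by
  obtain ⟨ψ, h1, h2⟩ := h
  rw [← h1, ← h2, ι.map_formula]

theorem exists_of_exists {P : (α → M) → Prop} {Q : (α → N) → Prop} (h : UD L P Q)
    (ι : M ↪ₑ[L] N) {x : α → N} (hx : Q x) : ∃ x, P x := by
  classical
  rcases isEmpty_or_nonempty M with hM | hM
  · have : IsEmpty α := ⟨fun a => by
      have : Nonempty N := ⟨x a⟩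
      have h1 := (L.model_nonemptyTheory_iff (M := N)).2 this
      exact (not_nonempty_iff.2 hM) (L.model_nonemptyTheory_iff.1 ((ι.theory_model_iff _).2 h1))⟩
    refine ⟨isEmptyElim, (h.comp_iff ι _).2 ?_⟩
    rwa [Subsingleton.elim (ι ∘ isEmptyElim) x]
  · obtain ⟨ψ, h1, h2⟩ := h
    have hN : ψ.exClosure.Realize N := (Formula.realize_exClosure ψ).2 ⟨fun a => x a,
      (BoundedFormula.realize_restrictFreeVar (f := id) x fun _ => rfl).2 ((h2 x).2 hx)⟩
    obtain ⟨y, hy⟩ := (Formula.realize_exClosure ψ).1 ((ι.map_sentence _).2 hN)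
    refine ⟨fun a => if ha : a ∈ ψ.freeVarFinset then y ⟨a, ha⟩ else Classical.arbitrary M,
      (h1 _).1 ((BoundedFormula.realize_restrictFreeVar _ fun a => ?_).1 hy)⟩
    simp

theorem forall_of_forall {P : (α → M) → Prop} {Q : (α → N) → Prop} (h : UD L P Q)
    (ι : M ↪ₑ[L] N) (hP : ∀ x, P x) (x : α → N) : Q x := by
  by_contra hx
  obtain ⟨y, hy⟩ := h.not.exists_of_exists ι hx
  exact hy (hP y)

end UD

theorem D1.exists_formula {P : M → Prop} (hP : D1 L univ P) :
    ∃ ψ : L.Formula (↥(univ : Set M) ⊕ Fin 1),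
      ∀ x, P x ↔ ψ.Realize (Sum.elim (fun a => (a : M)) fun _ => x) := by
  obtain ⟨ψ, hψ⟩ := Set.definable_iff_exists_formula_sum.1 hP
  exact ⟨ψ, fun x => Set.ext_iff.1 hψ fun _ => x⟩

theorem D1.of_formula {β : Type*} (ψ : L.Formula (β ⊕ Fin 1)) (a : β → M) :
    D1 L univ fun x => ψ.Realize (Sum.elim a fun _ => x) := by
  refine Set.definable_iff_exists_formula_sum.2
    ⟨ψ.relabel (Sum.map (fun i => ⟨a i, trivial⟩) id), ?_⟩
  ext x
  rw [Set.mem_ofPred_eq, Set.mem_ofPred_eq, Formula.realize_relabel]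
  refine iff_of_eq (congrArg _ (funext fun j => ?_))
  rcases j with j | j
  · rfl
  · exact congrArg x (Subsingleton.elim _ _)

theorem D2.lt [L.IsOrdered] [LinearOrder M] [L.OrderedStructure M] :
    D2 L (∅ : Set M) fun a b => a < b := by
  obtain ⟨ψ, hψ, -⟩ := UD.lt (L := L) (M := M) (N := M) (0 : Fin 2) 1
  refine Set.empty_definable_iff.2 ⟨ψ, ?_⟩
  ext x
  exact (hψ x).symm

theorem LOM.transfer [L.IsOrdered] [LinearOrder M] [L.OrderedStructure M] [LinearOrder N]
    [L.OrderedStructure N] (h : LOM L M) (ι : M ↪ₑ[L] N) : LOM L N where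
  dense a b := by
    have key : UD L (fun x : Fin 2 → M => x 0 < x 1 → ∃ c, x 0 < c ∧ c < x 1)
        (fun x : Fin 2 → N => x 0 < x 1 → ∃ c, x 0 < c ∧ c < x 1) :=
      .imp (.lt _ _) <| .ex <| .and (.lt _ _) (.lt _ _)
    exact key.forall_of_forall ι (fun x => h.dense _ _) ![a, b]
  noMax a := by
    have key : UD L (fun x : Fin 1 → M => ∃ c, x 0 < c) (fun x : Fin 1 → N => ∃ c, x 0 < c) :=
      .ex <| .lt _ _
    exact key.forall_of_forall ι (fun x => h.noMax _) ![a]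
  noMin a := by
    have key : UD L (fun x : Fin 1 → M => ∃ c, c < x 0) (fun x : Fin 1 → N => ∃ c, c < x 0) :=
      .ex <| .lt _ _
    exact key.forall_of_forall ι (fun x => h.noMin _) ![a]
  lt_def := D2.lt
  right P hP a := by
    obtain ⟨ψ, hψ⟩ := hP.exists_formula
    have key : UD L
        (fun x : ↥(univ : Set N) ⊕ Fin 1 → M => ∃ b, x (.inr 0) < b ∧
          ((∀ y, x (.inr 0) < y → y < b → ψ.Realize (Sum.elim (fun i => x (.inl i)) fun _ => y)) ∨
          ∀ y, x (.inr 0) < y → y < b → ¬ ψ.Realize (Sum.elim (fun i => x (.inl i)) fun _ => y)))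
        (fun x : ↥(univ : Set N) ⊕ Fin 1 → N => ∃ b, x (.inr 0) < b ∧
          ((∀ y, x (.inr 0) < y → y < b → ψ.Realize (Sum.elim (fun i => x (.inl i)) fun _ => y)) ∨
          ∀ y, x (.inr 0) < y → y < b → ¬ ψ.Realize (Sum.elim (fun i => x (.inl i)) fun _ => y))) :=
      .ex <| .and (.lt _ _) <| .or
        (.all <| .imp (.lt _ _) <| .imp (.lt _ _) <| .base ψ _ _)
        (.all <| .imp (.lt _ _) <| .imp (.lt _ _) <| .not <| .base ψ _ _)
    simpa only [Sum.elim_inl, Sum.elim_inr, ← hψ] using key.forall_of_forall ι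
      (fun x => h.right _ (D1.of_formula ψ _) _) (Sum.elim (fun i => i) fun _ => a)
  left P hP a := by
    obtain ⟨ψ, hψ⟩ := hP.exists_formula
    have key : UD L
        (fun x : ↥(univ : Set N) ⊕ Fin 1 → M => ∃ b, b < x (.inr 0) ∧
          ((∀ y, b < y → y < x (.inr 0) → ψ.Realize (Sum.elim (fun i => x (.inl i)) fun _ => y)) ∨
          ∀ y, b < y → y < x (.inr 0) → ¬ ψ.Realize (Sum.elim (fun i => x (.inl i)) fun _ => y)))
        (fun x : ↥(univ : Set N) ⊕ Fin 1 → N => ∃ b, b < x (.inr 0) ∧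
          ((∀ y, b < y → y < x (.inr 0) → ψ.Realize (Sum.elim (fun i => x (.inl i)) fun _ => y)) ∨
          ∀ y, b < y → y < x (.inr 0) → ¬ ψ.Realize (Sum.elim (fun i => x (.inl i)) fun _ => y))) :=
      .ex <| .and (.lt _ _) <| .or
        (.all <| .imp (.lt _ _) <| .imp (.lt _ _) <| .base ψ _ _)
        (.all <| .imp (.lt _ _) <| .imp (.lt _ _) <| .not <| .base ψ _ _)
    simpa only [Sum.elim_inl, Sum.elim_inr, ← hψ] using key.forall_of_forall ι
      (fun x => h.left _ (D1.of_formula ψ _) _) (Sum.elim (fun i => i) fun _ => a)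
  inf P hP := by
    obtain ⟨ψ, hψ⟩ := hP.exists_formula
    have key : UD L
        (fun x : ↥(univ : Set N) → M => (∃ y, ψ.Realize (Sum.elim (fun i => x i) fun _ => y)) →
          (∃ e, ∀ y, ψ.Realize (Sum.elim (fun i => x i) fun _ => y) → e ≤ y) →
          ∃ s, (∀ y, ψ.Realize (Sum.elim (fun i => x i) fun _ => y) → s ≤ y) ∧
            ∀ e, (∀ y, ψ.Realize (Sum.elim (fun i => x i) fun _ => y) → e ≤ y) → e ≤ s)
        (fun x : ↥(univ : Set N) → N => (∃ y, ψ.Realize (Sum.elim (fun i => x i) fun _ => y)) →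
          (∃ e, ∀ y, ψ.Realize (Sum.elim (fun i => x i) fun _ => y) → e ≤ y) →
          ∃ s, (∀ y, ψ.Realize (Sum.elim (fun i => x i) fun _ => y) → s ≤ y) ∧
            ∀ e, (∀ y, ψ.Realize (Sum.elim (fun i => x i) fun _ => y) → e ≤ y) → e ≤ s) :=
      .imp (.ex <| .base ψ _ _) <| .imp (.ex <| .all <| .imp (.base ψ _ _) (.le _ _)) <| .ex <|
        .and (.all <| .imp (.base ψ _ _) (.le _ _)) <|
        .all <| .imp (.all <| .imp (.base ψ _ _) (.le _ _)) (.le _ _)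
    simpa only [← hψ] using key.forall_of_forall ι
      (fun x => h.inf _ (D1.of_formula ψ _)) fun i => i
  sup P hP := by
    obtain ⟨ψ, hψ⟩ := hP.exists_formula
    have key : UD L
        (fun x : ↥(univ : Set N) → M => (∃ y, ψ.Realize (Sum.elim (fun i => x i) fun _ => y)) →
          (∃ e, ∀ y, ψ.Realize (Sum.elim (fun i => x i) fun _ => y) → y ≤ e) →
          ∃ s, (∀ y, ψ.Realize (Sum.elim (fun i => x i) fun _ => y) → y ≤ s) ∧
            ∀ e, (∀ y, ψ.Realize (Sum.elim (fun i => x i) fun _ => y) → y ≤ e) → s ≤ e)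
        (fun x : ↥(univ : Set N) → N => (∃ y, ψ.Realize (Sum.elim (fun i => x i) fun _ => y)) →
          (∃ e, ∀ y, ψ.Realize (Sum.elim (fun i => x i) fun _ => y) → y ≤ e) →
          ∃ s, (∀ y, ψ.Realize (Sum.elim (fun i => x i) fun _ => y) → y ≤ s) ∧
            ∀ e, (∀ y, ψ.Realize (Sum.elim (fun i => x i) fun _ => y) → y ≤ e) → s ≤ e) :=
      .imp (.ex <| .base ψ _ _) <| .imp (.ex <| .all <| .imp (.base ψ _ _) (.le _ _)) <| .ex <|
        .and (.all <| .imp (.base ψ _ _) (.le _ _)) <|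
        .all <| .imp (.all <| .imp (.base ψ _ _) (.le _ _)) (.le _ _)
    simpa only [← hψ] using key.forall_of_forall ι
      (fun x => h.sup _ (D1.of_formula ψ _)) fun i => i

end Transfer

section Semantics

variable {L : FirstOrder.Language.{v, w}} {M : Type u}

open Filter Topology

theorem eventually_nhdsGT_or [LinearOrder M] [TopologicalSpace M] [OrderTopology M] {J : Set M}
    (hJ : J.OrdConnected) (a : M) : (∀ᶠ x in 𝓝[>] a, x ∈ J) ∨ ∀ᶠ x in 𝓝[>] a, x ∉ J := by
  refine or_iff_not_imp_right.2 fun hcon => ?_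
  have hfreq : ∃ᶠ x in 𝓝[>] a, x ∈ J := hcon
  obtain ⟨x₀, hx₀, hax₀⟩ := (hfreq.and_eventually self_mem_nhdsWithin).exists
  filter_upwards [Ioo_mem_nhdsGT hax₀] with y hy
  obtain ⟨x, hx, hxy⟩ := (hfreq.and_eventually (Ioo_mem_nhdsGT hy.1)).exists
  exact hJ.out hx hx₀ ⟨hxy.2.le, hy.2.le⟩

theorem eventually_nhdsLT_or [LinearOrder M] [TopologicalSpace M] [OrderTopology M] {J : Set M}
    (hJ : J.OrdConnected) (a : M) : (∀ᶠ x in 𝓝[<] a, x ∈ J) ∨ ∀ᶠ x in 𝓝[<] a, x ∉ J :=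
  eventually_nhdsGT_or (M := Mᵒᵈ) hJ.dual a

theorem eventually_iUnion_or {β : Type*} [Finite β] {f : Filter M} {J : β → Set M}
    (h : ∀ i, (∀ᶠ x in f, x ∈ J i) ∨ ∀ᶠ x in f, x ∉ J i) :
    (∀ᶠ x in f, x ∈ ⋃ i, J i) ∨ ∀ᶠ x in f, x ∉ ⋃ i, J i := by
  by_cases hex : ∃ i, ∀ᶠ x in f, x ∈ J i
  · obtain ⟨i, hi⟩ := hex
    exact Or.inl (hi.mono fun x hx => Set.mem_iUnion.2 ⟨i, hx⟩)
  · have := eventually_all.2 fun i => (h i).resolve_left (not_exists.1 hex i)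
    exact Or.inr (this.mono fun x hx => by simpa using hx)

theorem ordConnected_of_isOInterval [LinearOrder M] {J : Set M} (hJ : IsOInterval J) :
    J.OrdConnected := by
  rcases hJ with ⟨a, b, rfl⟩ | ⟨a, rfl⟩ | ⟨b, rfl⟩ | rfl
  exacts [Set.ordConnected_Ioo, Set.ordConnected_Ioi, Set.ordConnected_Iio, Set.ordConnected_univ]

theorem isOpen_of_isOInterval [LinearOrder M] [TopologicalSpace M] [OrderTopology M] {J : Set M}
    (hJ : IsOInterval J) : IsOpen J := by
  rcases hJ with ⟨a, b, rfl⟩ | ⟨a, rfl⟩ | ⟨b, rfl⟩ | rfl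
  exacts [isOpen_Ioo, isOpen_Ioi, isOpen_Iio, isOpen_univ]

variable [L.Structure M]

theorem eventually_or_of_locallyOMinimal [LinearOrder M] [TopologicalSpace M] [OrderTopology M]
    (hlo : LocallyOMinimal L M) {P : M → Prop} (hP : D1 L univ P) (a : M) {f : Filter M}
    (hfa : f ≤ 𝓝 a)
    (hf : ∀ J : Set M, J.OrdConnected → (∀ᶠ x in f, x ∈ J) ∨ ∀ᶠ x in f, x ∉ J) :
    (∀ᶠ x in f, P x) ∨ ∀ᶠ x in f, ¬ P x := by
  obtain ⟨I, hI, haI, F, k, J, hJ, hPI⟩ := hlo {x | P x} hP a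
  have hIf : ∀ᶠ x in f, x ∈ I := hfa ((isOpen_of_isOInterval hI).mem_nhds haI)
  have hunion : {x | P x} ∩ I = ⋃ i : F ⊕ Fin k, Sum.elim (fun y : F => {(y : M)}) J i := by
    rw [hPI]
    ext x
    simp
  have := eventually_iUnion_or (f := f) (J := Sum.elim (fun y : F => {(y : M)}) J) (by
    rintro (i | i)
    · exact hf _ Set.ordConnected_singleton
    · exact hf _ (ordConnected_of_isOInterval (hJ i)))
  rw [← hunion] at this
  refine this.imp (fun h => h.mono fun x hx => hx.1) fun h => ?_
  filter_upwards [h, hIf] with x hx hxI hPx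
  exact hx ⟨hPx, hxI⟩

theorem LOM.of_locallyOMinimal [L.IsOrdered] [LinearOrder M] [L.OrderedStructure M]
    [DenselyOrdered M] [NoMaxOrder M] [NoMinOrder M] [TopologicalSpace M] [OrderTopology M]
    (hlo : LocallyOMinimal L M) (hdc : DefinablyComplete L M) : LOM L M where
  dense _ _ hab := exists_between hab
  noMax := exists_gt
  noMin := exists_lt
  lt_def := D2.lt
  right P hP a := by
    rcases eventually_or_of_locallyOMinimal hlo hP a nhdsWithin_le_nhds
      (fun J hJ => eventually_nhdsGT_or hJ a) with h | h <;>
    obtain ⟨b, hb, hbP⟩ := mem_nhdsGT_iff_exists_Ioo_subset.1 h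
    · exact ⟨b, hb, Or.inl fun x hx hx' => hbP ⟨hx, hx'⟩⟩
    · exact ⟨b, hb, Or.inr fun x hx hx' => hbP ⟨hx, hx'⟩⟩
  left P hP a := by
    rcases eventually_or_of_locallyOMinimal hlo hP a nhdsWithin_le_nhds
      (fun J hJ => eventually_nhdsLT_or hJ a) with h | h <;>
    obtain ⟨b, hb, hbP⟩ := mem_nhdsLT_iff_exists_Ioo_subset.1 h
    · exact ⟨b, hb, Or.inl fun x hx hx' => hbP ⟨hx, hx'⟩⟩
    · exact ⟨b, hb, Or.inr fun x hx hx' => hbP ⟨hx, hx'⟩⟩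
  inf P hP hne := by
    rintro ⟨e, he⟩
    obtain ⟨s, hs⟩ := (hdc {x | P x} hP hne).2 ⟨e, fun x hx => he x hx⟩
    exact ⟨s, fun x hx => hs.1 hx, fun e he => hs.2 fun x hx => he x hx⟩
  sup P hP hne := by
    rintro ⟨e, he⟩
    obtain ⟨s, hs⟩ := (hdc {x | P x} hP hne).1 ⟨e, fun x hx => he x hx⟩
    exact ⟨s, fun x hx => hs.1 hx, fun e he => hs.2 fun x hx => he x hx⟩

/-- The projection along `σ` of the set defined by `φ` with parameters `c` contains an open box. -/
def HasBox [LinearOrder M] {m n d : ℕ} (φ : L.Formula (Fin m ⊕ Fin n)) (σ : Fin d ↪ Fin n)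
    (c : Fin m → M) : Prop :=
  ∃ lo hi : Fin d → M, (∀ i, lo i < hi i) ∧ ∀ x : Fin d → M, (∀ i, lo i < x i ∧ x i < hi i) →
    ∃ y : Fin n → M, φ.Realize (Sum.elim c y) ∧ ∀ i, y (σ i) = x i

theorem hasBox_comp [L.IsOrdered] [LinearOrder M] [L.OrderedStructure M] {N : Type u}
    [LinearOrder N] [L.Structure N] [L.OrderedStructure N] (ι : M ↪ₑ[L] N) {m n d : ℕ}
    (φ : L.Formula (Fin m ⊕ Fin n)) (σ : Fin d ↪ Fin n) (c : Fin m → M) :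
    HasBox φ σ c ↔ HasBox φ σ (ι ∘ c) := by
  have key : UD L (fun c : Fin m → M => HasBox φ σ c) (fun c : Fin m → N => HasBox φ σ c) := by
    refine .exs <| .exs <| .and (.forall_finite fun i => .lt _ _) <| .alls <|
      .imp (.forall_finite fun i => .and (.lt _ _) (.lt _ _)) <| .exs <|
      .and (.base φ _ _) (.forall_finite fun i => .eq _ _)
  exact key.comp_iff ι c

theorem hasBox_iff_interior_nonempty [LinearOrder M] [TopologicalSpace M] [OrderTopology M]
    [DenselyOrdered M] [NoMaxOrder M] [NoMinOrder M] {m n d : ℕ} (φ : L.Formula (Fin m ⊕ Fin n))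
    (σ : Fin d ↪ Fin n) (c : Fin m → M) : HasBox φ σ c ↔
      (interior ((fun x => x ∘ σ) '' {x : Fin n → M | φ.Realize (Sum.elim c x)})).Nonempty := by
  constructor
  · rintro ⟨lo, hi, hlh, hbox⟩
    choose x hx hx' using fun i => exists_between (hlh i)
    have hopen : IsOpen (Set.univ.pi fun i => Set.Ioo (lo i) (hi i)) :=
      isOpen_set_pi Set.finite_univ fun i _ => isOpen_Ioo
    refine ⟨x, interior_maximal ?_ hopen fun i _ => ⟨hx i, hx' i⟩⟩
    intro y hy
    obtain ⟨z, hz, hzy⟩ := hbox y fun i => hy i trivial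
    exact ⟨z, hz, funext hzy⟩
  · rintro ⟨x, hx⟩
    obtain ⟨u, hu, hsub⟩ := isOpen_pi_iff'.1 isOpen_interior x hx
    choose lo hi hlh hlu using fun i =>
      mem_nhds_iff_exists_Ioo_subset.1 ((hu i).1.mem_nhds (hu i).2)
    refine ⟨lo, hi, fun i => (hlh i).1.trans (hlh i).2, fun y hy => ?_⟩
    obtain ⟨z, hz, rfl⟩ := interior_subset (hsub fun i _ => hlu i (hy i))
    exact ⟨z, hz, fun i => rfl⟩

theorem LOM.hasBox_iff_exists_indep [LinearOrder M] (h : LOM L M) {κ : Cardinal.{u}}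
    (hκ : Cardinal.aleph0 ≤ κ) (hav : Avoids L M κ) {C : Set M} (hC : Cardinal.mk C ≤ κ)
    {m n d : ℕ} (φ : L.Formula (Fin m ⊕ Fin n)) (σ : Fin d ↪ Fin n) {c : Fin m → M}
    (hc : ∀ i, c i ∈ C) :
    HasBox φ σ c ↔ ∃ y : Fin n → M, φ.Realize (Sum.elim c y) ∧ Indep L C (y ∘ σ) := by
  constructor
  · rintro ⟨lo, hi, hlh, hbox⟩
    obtain ⟨v, hv, hvC⟩ := h.exists_indep hκ hav hC lo hi hlh
    obtain ⟨y, hy, hyv⟩ := hbox v hv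
    exact ⟨y, hy, by rwa [show y ∘ σ = v from funext hyv]⟩
  · rintro ⟨y, hy, hyC⟩
    have hφ : C.Definable L {y : Fin n → M | φ.Realize (Sum.elim c y)} := by
      refine Set.definable_iff_exists_formula_sum.2
        ⟨φ.relabel (Sum.map (fun i => ⟨c i, hc i⟩) id), ?_⟩
      ext x
      rw [Set.mem_ofPred_eq, Set.mem_ofPred_eq, Formula.realize_relabel]
      refine iff_of_eq (congrArg _ (funext fun j => ?_))
      rcases j with j | j <;> rfl
    have hY : Dfb L C (fun x => x ∈ (fun y : Fin n → M => y ∘ σ) ''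
      {y : Fin n → M | φ.Realize (Sum.elim c y)}) := hφ.image_comp_embedding σ
    obtain ⟨lo, hi, hlh, hbox⟩ := h.exists_box hκ hav hC hY ⟨y, hy, rfl⟩ hyC
    refine ⟨lo, hi, hlh, fun x hx => ?_⟩
    obtain ⟨z, hz, rfl⟩ := hbox x hx
    exact ⟨z, hz, fun i => rfl⟩

end Semantics

section Rank

variable {L : FirstOrder.Language.{v, w}} {M : Type u} [L.Structure M] [LinearOrder M]

theorem Indep.injective (h : LOM L M) {C : Set M} {d : ℕ} {v : Fin d → M} (hv : Indep L C v) :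
    Function.Injective v := by
  intro i j hij
  by_contra hne
  exact hv i (h.subset_cl _ (Or.inr ⟨j, fun hji => hne hji.symm, hij.symm⟩))

theorem LOM.exists_basis_of_indep (h : LOM L M) {C : Set M} {n d : ℕ} {y : Fin n → M}
    {σ : Fin d ↪ Fin n} (hy : Indep L C (y ∘ σ)) :
    ∃ s ⊆ Set.range y, (∀ x ∈ s, x ∉ cl L ((s \ {x}) ∪ C)) ∧ Set.range y ⊆ cl L (s ∪ C) ∧
      d ≤ s.ncard := by
  obtain ⟨s, hs₀, hs, hind, hspan⟩ := h.exists_basis (C := C) (s₀ := Set.range (y ∘ σ))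
    (Set.finite_range y) (Set.range_comp_subset_range σ y) (by
      rintro _ ⟨i, rfl⟩ hi
      refine hy i (cl_mono ?_ hi)
      rintro _ (⟨⟨j, rfl⟩, hji⟩ | hx)
      · exact Or.inr ⟨j, fun hj => hji (congrArg (y ∘ σ) hj), rfl⟩
      · exact Or.inl hx)
  refine ⟨s, hs, hind, hspan, ?_⟩
  have hcard := Set.ncard_le_ncard hs₀ ((Set.finite_range y).subset hs)
  rwa [Set.ncard_range_of_injective (hy.injective h), Nat.card_fin] at hcard

theorem exists_indep_of_basis {C : Set M} {n : ℕ} {y : Fin n → M} {s : Set M}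
    (hs : s ⊆ Set.range y) (hind : ∀ x ∈ s, x ∉ cl L ((s \ {x}) ∪ C)) :
    ∃ σ : Fin s.ncard ↪ Fin n, Indep L C (y ∘ σ) := by
  have : Finite s := (Set.finite_range y).subset hs
  let e : Fin s.ncard ≃ s := (Finite.equivFinOfCardEq (Nat.card_coe_set_eq s)).symm
  choose g hg using fun x : s => hs x.2
  have hinj : Function.Injective (g ∘ e) := fun i j hij => e.injective <| Subtype.ext <| by
    rw [← hg, ← hg (e j)]
    exact congrArg y hij
  have hgv : y ∘ (g ∘ e) = fun j => (e j : M) := funext fun j => hg (e j)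
  refine ⟨⟨g ∘ e, hinj⟩, fun i hi => ?_⟩
  rw [Function.Embedding.coeFn_mk, hgv] at hi
  refine hind _ (e i).2 (cl_mono ?_ hi)
  rintro _ (hx | ⟨j, hj, rfl⟩)
  · exact Or.inr hx
  · exact Or.inl ⟨(e j).2, fun hji => hj (e.injective (Subtype.ext hji))⟩

end Rank

end LocOMin

/-- Let `M` be a model of a definably complete locally o-minimal theory, `A ⊆ M`, and
`X ⊆ Mⁿ` a set definable over `A` (by a formula `φ` with a parameter tuple `c` from `A`).
Then `dim X` equals the rank `rk(X/A)` computed in a monster model `𝕄` with the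
discrete-closure pregeometry: the supremum over points `b ∈ X(𝕄)` of the cardinality of
a `discl`-basis of `{b 0, …, b (n-1)}` over `A`. -/
theorem projDim_eq_rank
    {L : FirstOrder.Language} {M 𝕄 : Type u} [L.IsOrdered]
    [LinearOrder M] [L.Structure M] [L.OrderedStructure M]
    [DenselyOrdered M] [NoMaxOrder M] [NoMinOrder M]
    [TopologicalSpace M] [OrderTopology M]
    [LinearOrder 𝕄] [L.Structure 𝕄] [L.OrderedStructure 𝕄]
    [TopologicalSpace 𝕄] [OrderTopology 𝕄]
    (hlo : LocallyOMinimal L M) (hdc : DefinablyComplete L M)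
    (ι : M ↪ₑ[L] 𝕄)
    (hmonster : RealizesSmallTypes L 𝕄 (Order.succ (max (Cardinal.mk M) Cardinal.aleph0)))
    (A : Set M) {m n : ℕ} (φ : L.Formula (Fin m ⊕ Fin n)) (c : Fin m → M)
    (hc : ∀ i, c i ∈ A) :
    projDim {x : Fin n → M | φ.Realize (Sum.elim c x)} =
      ⨆ b ∈ {x : Fin n → 𝕄 | φ.Realize (Sum.elim (ι ∘ c) x)},
        ⨆ s ∈ {s : Set 𝕄 | s ⊆ Set.range b ∧
          (∀ x ∈ s, x ∉ discl L 𝕄 ((s \ {x}) ∪ ι '' A)) ∧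
          Set.range b ⊆ discl L 𝕄 (s ∪ ι '' A)},
          ((s.ncard : ℕ∞) : WithBot ℕ∞) := by
  have h : LocOMin.LOM L M := .of_locallyOMinimal hlo hdc
  have h' : LocOMin.LOM L 𝕄 := h.transfer ι
  have hκ : Cardinal.aleph0 ≤ max (Cardinal.mk M) Cardinal.aleph0 := le_max_right _ _
  have hav : LocOMin.Avoids L 𝕄 (max (Cardinal.mk M) Cardinal.aleph0) :=
    fun S hS a b hab => h'.exists_notMem_cl hκ hmonster hS hab
  have hA : Cardinal.mk ↑(ι '' A) ≤ max (Cardinal.mk M) Cardinal.aleph0 :=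
    Cardinal.mk_image_le.trans ((Cardinal.mk_set_le A).trans (le_max_left _ _))
  have hdim : ∀ d, HasDimWit {x : Fin n → M | φ.Realize (Sum.elim c x)} d ↔
      ∃ σ : Fin d ↪ Fin n, ∃ y : Fin n → 𝕄, φ.Realize (Sum.elim (ι ∘ c) y) ∧
        LocOMin.Indep L (ι '' A) (y ∘ σ) := fun d => exists_congr fun σ => by
    rw [← LocOMin.hasBox_iff_interior_nonempty, LocOMin.hasBox_comp ι]
    exact h'.hasBox_iff_exists_indep hκ hav hA φ σ fun i => ⟨c i, hc i, rfl⟩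
  simp only [h'.discl_eq_cl]
  refine le_antisymm (iSup₂_le fun d hd => ?_) (iSup₂_le fun b hb => iSup₂_le fun s hs => ?_)
  · obtain ⟨σ, y, hy, hind⟩ := (hdim d).1 hd
    obtain ⟨s, hs, hsi, hspan, hcard⟩ := h'.exists_basis_of_indep hind
    exact le_iSup₂_of_le y hy (le_iSup₂_of_le s ⟨hs, hsi, hspan⟩ (by exact_mod_cast hcard))
  · obtain ⟨σ, hσ⟩ := LocOMin.exists_indep_of_basis hs.1 hs.2.1
    exact le_iSup₂_of_le (f := fun (d : ℕ) (_ : d ∈ {d | HasDimWit _ d}) => ((d : ℕ∞) : WithBot ℕ∞))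
      s.ncard ((hdim _).2 ⟨σ, b, hb, hσ⟩) le_rfl
end
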